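/- Let k₀ be a field of characteristic 0, let Q be a quaternion division algebra over k₀ with conjugation q ↦ q̄, let n ≥ 2, and let q₁, …, q_n ∈ Q be nonzero pure quaternions (q̄_i = −q_i), with a_i = q_i² ∈ k₀^×. Let k = k₀((t₁))((t₂))…((t_n)) be the field of iterated Laurent series, and let σ be the involution on A = M_n(Q ⊗_{k₀} k) defined by σ(X) = D⁻¹·(X̄)ᵀ·D, where D is the diagonal matrix with diagonal entries t₁q₁, …, t_nq_n and X̄ is the entrywise conjugation of X. Assume there exist no λ ∈ k₀^× and nonzero c ∈ Q with q₂ = λ·c̄·q₁·c (i.e., the one-dimensional skew-hermitian forms ⟨q₁⟩ and ⟨q₂⟩ are not similar). If ℓ is a field extension of k of odd finite degree and g ∈ M_n(Q ⊗_{k₀} ℓ) satisfies σ_ℓ(g) = g and g² = λ·1 for some λ ∈ ℓ^× that is not a square in ℓ, then there exists μ ∈ k₀^× such that Q is isomorphic as a k₀-algebra to the quaternion algebra (a_i, μ)_{k₀} for every i = 1, …, n. -/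

import Mathlib

open scoped Quaternion

noncomputable section

/-- Auxiliary construction of the iterated Laurent series field
`k₀((t₁))…((t_n))`, together with its field structure. -/
def IterLaurentAux (k₀ : Type*) [Field k₀] : ℕ → Σ K : Type _, Field K
  | 0 => ⟨k₀, inferInstance⟩
  | n + 1 =>
    letI : Field (IterLaurentAux k₀ n).1 := (IterLaurentAux k₀ n).2
    ⟨LaurentSeries (IterLaurentAux k₀ n).1, inferInstance⟩

/-- The iterated Laurent series field `k = k₀((t₁))…((t_n))`. -/
def IterLaurent (k₀ : Type*) [Field k₀] (n : ℕ) : Type _ := (IterLaurentAux k₀ n).1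

instance instFieldIterLaurent (k₀ : Type*) [Field k₀] (n : ℕ) :
    Field (IterLaurent k₀ n) := (IterLaurentAux k₀ n).2

/-- The inclusion of constants `k₀ → k₀((t₁))…((t_n))`. -/
def iterLaurentEmb (k₀ : Type*) [Field k₀] : (n : ℕ) → (k₀ →+* IterLaurent k₀ n)
  | 0 => RingHom.id k₀
  | n + 1 =>
    (algebraMap (IterLaurent k₀ n)
      (LaurentSeries (IterLaurent k₀ n))).comp (iterLaurentEmb k₀ n)

/-- The variables `t₁, …, t_n` inside `k₀((t₁))…((t_n))`. -/
def iterLaurentVar (k₀ : Type*) [Field k₀] : (n : ℕ) → Fin n → IterLaurent k₀ n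
  | 0, i => i.elim0
  | n + 1, i =>
    if h : (i : ℕ) < n then
      algebraMap (IterLaurent k₀ n) (LaurentSeries (IterLaurent k₀ n))
        (iterLaurentVar k₀ n ⟨i, h⟩)
    else
      (HahnSeries.single (1 : ℤ) (1 : IterLaurent k₀ n) :
        LaurentSeries (IterLaurent k₀ n))

/-- The componentwise extension of scalars `ℍ[k₀,c₁,c₂] → ℍ[ℓ,f c₁,f c₂]` along a
ring homomorphism `f : k₀ →+* ℓ`. -/
def quatMap {k₀ ℓ : Type*} [Field k₀] [Field ℓ] (c₁ c₂ : k₀) (f : k₀ →+* ℓ)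
    (z : ℍ[k₀,c₁,c₂]) : ℍ[ℓ, f c₁, f c₂] :=
  ⟨f z.re, f z.imI, f z.imJ, f z.imK⟩

open Polynomial in
/-- Finite free modules over a precomplete ring are precomplete. -/
theorem aux_precomplete {A B : Type*} [CommRing A] [AddCommGroup B] [Module A B] (I : Ideal A)
    [IsPrecomplete I A] [Module.Finite A B] [Module.Free A B] : IsPrecomplete I B := by
  classical
  let b := Module.Free.chooseBasis A B
  have key : ∀ (m : ℕ) (x : B), x ∈ (I ^ m • ⊤ : Submodule A B) ↔ ∀ i, b.repr x i ∈ I ^ m := by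
    intro m x
    constructor
    · intro hx i
      have : b.coord i x ∈ Submodule.map (b.coord i) (I ^ m • ⊤ : Submodule A B) :=
        Submodule.mem_map_of_mem hx
      rw [Submodule.map_smul''] at this
      have h2 := Submodule.smul_mono (le_refl (I ^ m)) (le_top (a := Submodule.map (b.coord i) ⊤)) this
      simpa using h2
    · intro h
      rw [← b.sum_repr x]
      exact Submodule.sum_mem _ fun i _ => Submodule.smul_mem_smul (h i) trivial
  constructor
  intro f hf
  have h1 : ∀ i, ∃ l : A, ∀ n, b.repr (f n) i ≡ l [SMOD (I ^ n • ⊤ : Submodule A A)] := by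
    intro i
    apply IsPrecomplete.prec (I := I) (M := A) inferInstance
    intro m n hmn
    have := hf hmn
    rw [SModEq.sub_mem, key] at this
    rw [SModEq.sub_mem]
    simpa using this i
  choose l hl using h1
  refine ⟨∑ i, l i • b i, fun n => ?_⟩
  rw [SModEq.sub_mem, key]
  intro i
  have := hl i n
  rw [SModEq.sub_mem] at this
  have e : b.repr (∑ i, l i • b i) i = l i := by
    simp [Finsupp.single_apply]
  rw [map_sub, Finsupp.sub_apply, e]
  simpa using this

theorem aux_henselian {A B : Type*} [CommRing A] [IsNoetherianRing A] [CommRing B] [Algebra A B] (I : Ideal A)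
    [IsAdicComplete I A] [Module.Finite A B] [Module.Free A B] :
    HenselianRing B (I.map (algebraMap A B)) := by
  have h1 : IsPrecomplete I B := aux_precomplete I
  have h2 : IsHausdorff I B := IsHausdorff.of_le_jacobson I B (IsAdicComplete.le_jacobson_bot I)
  have h3 : IsPrecomplete (I.map (algebraMap A B)) B := IsPrecomplete.map_algebraMap_iff.2 h1
  have h4 : IsHausdorff (I.map (algebraMap A B)) B := IsHausdorff.map_algebraMap_iff.2 h2
  have h5 : IsAdicComplete (I.map (algebraMap A B)) B := { }
  infer_instance

open Polynomial in
theorem aux_local {B : Type*} [CommRing B] [IsDomain B] (J : Ideal B) [HenselianRing B J]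
    (hJ : J ≠ ⊤) [IsArtinianRing (B ⧸ J)] : IsLocalRing B ∧
      ∀ b : B, ¬ IsUnit b → ∃ n, b ^ n ∈ J := by
  have hjac := HenselianRing.jac (R := B) (I := J)
  have hunit : ∀ b : B, IsUnit (Ideal.Quotient.mk J b) → IsUnit b := by
    intro b hb
    obtain ⟨c, hc⟩ := hb.exists_right_inv
    obtain ⟨c, rfl⟩ := Ideal.Quotient.mk_surjective c
    have : b * c - 1 ∈ J := by
      rw [← Ideal.Quotient.eq_zero_iff_mem]; simp [hc]
    have h := Ideal.mem_jacobson_bot.1 (hjac this) 1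
    have : IsUnit (b * c) := by simpa using h
    exact isUnit_of_mul_isUnit_left this
  have main : ∀ b : B, ¬ IsUnit b → ∃ n, b ^ n ∈ J := by
    intro b hb
    obtain ⟨n, y, hy⟩ := IsArtinian.exists_pow_succ_smul_dvd (M := B ⧸ J) (Ideal.Quotient.mk J b) 1
    obtain ⟨y, rfl⟩ := Ideal.Quotient.mk_surjective y
    set x := Ideal.Quotient.mk J b with hx
    set z := Ideal.Quotient.mk J y with hz
    replace hy : x ^ n = x ^ (n + 1) * z := by simpa using hy.symm
    have hy2 : ∀ m, x ^ n = x ^ (n + m) * z ^ m := by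
      intro m
      induction m with
      | zero => simp
      | succ m ih =>
        calc x ^ n = x ^ n * x ^ m * z ^ m := by rw [← pow_add]; exact ih
          _ = x ^ (n + (m + 1)) * z ^ (m + 1) := by rw [hy]; ring
    have he : x ^ n * x ^ n * z ^ n = x ^ n := by rw [← pow_add]; exact (hy2 n).symm
    have hJu : Nontrivial (B ⧸ J) := Ideal.Quotient.nontrivial_iff.2 hJ
    obtain ⟨a, ha, ha'⟩ := HenselianRing.is_henselian (I := J) (X ^ 2 - X : B[X]) (by monicity!)
      (b ^ n * y ^ n) (by
        rw [← Ideal.Quotient.eq_zero_iff_mem]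
        simp only [eval_sub, eval_pow, eval_X, map_sub, map_pow, map_mul, ← hx, ← hz]
        linear_combination z ^ n * he) (by
        have e2 : eval (b ^ n * y ^ n) (derivative (X ^ 2 - X : B[X])) = 2 * (b ^ n * y ^ n) - 1 := by
          simp [one_add_one_eq_two]
        rw [e2]
        simp only [map_sub, map_pow, map_mul, map_one, map_ofNat, ← hx, ← hz]
        refine IsUnit.of_mul_eq_one (2 * (x ^ n * z ^ n) - 1) ?_
        linear_combination 4 * z ^ n * he)
    have haq : Ideal.Quotient.mk J a = x ^ n * z ^ n := by
      have := (Ideal.Quotient.eq_zero_iff_mem (I := J)).2 ha'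
      simp only [map_sub, map_pow, map_mul, ← hx, ← hz] at this
      linear_combination this
    have ha2 : a * (a - 1) = 0 := by
      have := ha.eq_zero
      simp at this
      linear_combination this
    rcases mul_eq_zero.1 ha2 with h | h
    · refine ⟨n, ?_⟩
      rw [← Ideal.Quotient.eq_zero_iff_mem, map_pow, ← hx, ← he]
      rw [h, map_zero] at haq
      linear_combination -x ^ n * haq
    · exfalso
      apply hb
      apply hunit
      rw [sub_eq_zero.1 h, map_one] at haq
      rcases Nat.eq_zero_or_pos n with rfl | hpos
      · exact IsUnit.of_mul_eq_one z (by simpa using hy.symm)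
      · have : IsUnit (x ^ n) := IsUnit.of_mul_eq_one _ haq.symm
        exact (isUnit_pow_iff hpos.ne').1 this
  refine ⟨?_, main⟩
  have : Nontrivial B := inferInstance
  refine IsLocalRing.of_isUnit_or_isUnit_one_sub_self fun b => ?_
  by_contra h
  push Not at h
  obtain ⟨n, hn⟩ := main b h.1
  apply h.2
  apply hunit
  have : IsNilpotent (Ideal.Quotient.mk J b) := ⟨n, by rw [← map_pow, Ideal.Quotient.eq_zero_iff_mem]; exact hn⟩
  simpa using this.isUnit_one_sub

open Polynomial in
/-- units congruent to a square modulo the maximal ideal are squares -/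
theorem aux_sqrt {B : Type*} [CommRing B] (h2 : IsUnit (2 : B)) [IsLocalRing B] (J : Ideal B) [HenselianRing B J]
    (hnil : ∀ b : B, ¬ IsUnit b → ∃ n, b ^ n ∈ J) (u y : B) (hu : IsUnit u)
    (h : u - y ^ 2 ∈ IsLocalRing.maximalIdeal B) : ∃ z, z ^ 2 = u := by
  have hy : IsUnit y := by
    by_contra hy
    have h3 : u - y ^ 2 + y * y ∈ IsLocalRing.maximalIdeal B :=
      Ideal.add_mem _ h (Ideal.mul_mem_left _ _ hy)
    apply h3
    convert hu using 1
    ring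
  obtain ⟨n, hn⟩ := hnil _ h
  have h4 : IsNilpotent (Ideal.Quotient.mk J (u - y ^ 2)) :=
    ⟨n, by rw [← map_pow, Ideal.Quotient.eq_zero_iff_mem]; exact hn⟩
  have h5 := Polynomial.existsUnique_nilpotent_sub_and_aeval_eq_zero (R := B) (S := B ⧸ J)
    (P := X ^ 2 - C u) (x := Ideal.Quotient.mk J y) (by
      have : aeval (Ideal.Quotient.mk J y) (X ^ 2 - C u : B[X]) = -(Ideal.Quotient.mk J (u - y ^ 2)) := by
        simp
      rw [this]
      exact h4.neg) (by
      have : aeval (Ideal.Quotient.mk J y) (derivative (X ^ 2 - C u : B[X])) = Ideal.Quotient.mk J (2 * y) := by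
        simp [one_add_one_eq_two]
      rw [this]
      exact (h2.mul hy).map _)
  obtain ⟨r, ⟨hr1, hr2⟩, -⟩ := h5
  obtain ⟨r, rfl⟩ := Ideal.Quotient.mk_surjective r
  have hr3 : r ^ 2 - u ∈ J := by
    rw [← Ideal.Quotient.eq_zero_iff_mem]
    simpa using hr2
  have hr4 : IsUnit (Ideal.Quotient.mk J r) := by
    have e : Ideal.Quotient.mk J r * Ideal.Quotient.mk J r = Ideal.Quotient.mk J u := by
      have := (Ideal.Quotient.eq_zero_iff_mem (I := J)).2 hr3
      simp only [map_sub, map_pow] at this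
      linear_combination this
    exact isUnit_of_mul_isUnit_left (e ▸ hu.map (Ideal.Quotient.mk J))
  obtain ⟨z, hz, -⟩ := HenselianRing.is_henselian (I := J) (X ^ 2 - C u : B[X]) (by monicity!) r
    (by simpa using hr3) (by
      have : eval r (derivative (X ^ 2 - C u : B[X])) = 2 * r := by simp [one_add_one_eq_two]
      rw [this, map_mul]
      exact (h2.map _).mul hr4)
  refine ⟨z, ?_⟩
  have := hz.eq_zero
  simp at this
  linear_combination this

universe u v
open PowerSeries in
theorem aux_order_nonneg {K : Type*} [Field K] (p : K⟦X⟧) :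
    0 ≤ (algebraMap K⟦X⟧ (LaurentSeries K) p).order := by
  by_cases hp : algebraMap K⟦X⟧ (LaurentSeries K) p = 0
  · simp [hp]
  by_contra! h
  apply HahnSeries.coeff_order_eq_zero.not.2 hp
  change (p : LaurentSeries K).coeff _ = 0
  rw [PowerSeries.coeff_coe, if_pos h]

open PowerSeries in
theorem aux_odd_order {K : Type u} [Field K] {L : Type v} [Field L]
    [Algebra (LaurentSeries K) L] [FiniteDimensional (LaurentSeries K) L]
    [Algebra K⟦X⟧ L] [IsScalarTower K⟦X⟧ (LaurentSeries K) L]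
    (hodd : Odd (Module.finrank (LaurentSeries K) L)) (z : L) (hz : z ≠ 0)
    (h1 : IsIntegral K⟦X⟧
      (algebraMap (LaurentSeries K) L (HahnSeries.single (1 : ℤ) (1 : K)) * z ^ 2))
    (h2 : IsIntegral K⟦X⟧
      (algebraMap (LaurentSeries K) L (HahnSeries.single (1 : ℤ) (1 : K)) * z ^ 2)⁻¹) : False := by
  have h1' := Algebra.isIntegral_norm (K := LaurentSeries K) h1
  have h2' := Algebra.isIntegral_norm (K := LaurentSeries K) h2
  obtain ⟨p, hp⟩ := IsIntegrallyClosed.isIntegral_iff.1 h1'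
  obtain ⟨r, hr⟩ := IsIntegrallyClosed.isIntegral_iff.1 h2'
  have o1 := aux_order_nonneg p
  have o2 := aux_order_nonneg r
  rw [hp] at o1
  rw [hr] at o2
  have hs : (HahnSeries.single (1 : ℤ) (1 : K) : LaurentSeries K) ≠ 0 := by simp
  have hN : Algebra.norm (LaurentSeries K) z ≠ 0 := Algebra.norm_ne_zero_iff.2 hz
  have e : Algebra.norm (LaurentSeries K)
    (algebraMap (LaurentSeries K) L (HahnSeries.single (1 : ℤ) (1 : K)) * z ^ 2) =
      (HahnSeries.single (1 : ℤ) (1 : K) : LaurentSeries K) ^ Module.finrank (LaurentSeries K) L *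
        Algebra.norm (LaurentSeries K) z ^ 2 := by
    rw [map_mul, map_pow, Algebra.norm_algebraMap]
  have hne : Algebra.norm (LaurentSeries K)
    (algebraMap (LaurentSeries K) L (HahnSeries.single (1 : ℤ) (1 : K)) * z ^ 2) ≠ 0 := by
    rw [e]; exact mul_ne_zero (pow_ne_zero _ hs) (pow_ne_zero _ hN)
  have hy : algebraMap (LaurentSeries K) L (HahnSeries.single (1 : ℤ) (1 : K)) * z ^ 2 ≠ 0 :=
    fun h => hne (by rw [h, Algebra.norm_zero])
  have o3 := HahnSeries.order_mul hne (Algebra.norm_ne_zero_iff.2 (inv_ne_zero hy))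
  rw [← map_mul, mul_inv_cancel₀ hy, map_one, HahnSeries.order_one] at o3
  have o4 : (Algebra.norm (LaurentSeries K)
    (algebraMap (LaurentSeries K) L (HahnSeries.single (1 : ℤ) (1 : K)) * z ^ 2)).order = 0 := by
    have o3' : (0 : ℤ) = (Algebra.norm (LaurentSeries K)
      (algebraMap (LaurentSeries K) L (HahnSeries.single (1 : ℤ) (1 : K)) * z ^ 2)).order +
      (Algebra.norm (LaurentSeries K)
      (algebraMap (LaurentSeries K) L (HahnSeries.single (1 : ℤ) (1 : K)) * z ^ 2)⁻¹).order := o3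
    omega
  rw [e, HahnSeries.order_mul (pow_ne_zero _ hs) (pow_ne_zero _ hN), HahnSeries.order_pow,
    HahnSeries.order_pow, HahnSeries.order_single one_ne_zero] at o4
  obtain ⟨m, hm⟩ := hodd
  rw [hm] at o4
  simp at o4
  omega

open PowerSeries in
theorem aux_residue {K : Type u} [Field K] {B : Type v} [CommRing B] [IsLocalRing B]
    [Algebra K⟦X⟧ B] [hlies : (IsLocalRing.maximalIdeal B).LiesOver (Ideal.span {(X : K⟦X⟧)})]
    [(Ideal.span {(X : K⟦X⟧)}).IsMaximal]
    (hfodd : Odd ((Ideal.span {(X : K⟦X⟧)}).inertiaDeg' (IsLocalRing.maximalIdeal B))) :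
    ∃ (L' : Type v) (_ : Field L') (_ : Algebra K L')
      (_ : FiniteDimensional K L') (ρ : B →+* L'), Odd (Module.finrank K L') ∧
      Function.Surjective ρ ∧ (∀ x, ρ x = 0 ↔ x ∈ IsLocalRing.maximalIdeal B) ∧
      ∀ c : K, ρ (algebraMap K⟦X⟧ B (C c)) = algebraMap K L' c := by
  let P := IsLocalRing.maximalIdeal B
  let I : Ideal K⟦X⟧ := Ideal.span {X}
  let ι : K →+* B := (algebraMap K⟦X⟧ B).comp (C (R := K))
  let fieldP : Field (B ⧸ P) := Ideal.Quotient.field P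
  let algK : Algebra K (B ⧸ P) := RingHom.toAlgebra (R := K) (S := B ⧸ P) ((Ideal.Quotient.mk P).comp ι)
  have hfr : Module.finrank K (B ⧸ P) = I.inertiaDeg' P := by
    have h1 : I.inertiaDeg' P = Module.finrank (K⟦X⟧ ⧸ I) (B ⧸ P) := Ideal.inertiaDeg'_algebraMap I P
    rw [h1]
    let e : K ≃+* K⟦X⟧ ⧸ I := RingEquiv.ofBijective ((Ideal.Quotient.mk I).comp (C (R := K))) (by
      refine ⟨RingHom.injective _, fun y => ?_⟩
      obtain ⟨y, rfl⟩ := Ideal.Quotient.mk_surjective y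
      refine ⟨constantCoeff y, ?_⟩
      rw [RingHom.comp_apply, Ideal.Quotient.eq, Ideal.mem_span_singleton, X_dvd_iff]
      simp)
    refine Algebra.finrank_eq_of_equiv_equiv e (RingEquiv.refl _) ?_
    ext x
    rfl
  have hodd' : Odd (Module.finrank K (B ⧸ P)) := hfr ▸ hfodd
  have hfin : FiniteDimensional K (B ⧸ P) :=
    Module.finite_of_finrank_pos hodd'.pos
  exact ⟨B ⧸ P, fieldP, algK, hfin, Ideal.Quotient.mk P, hodd', Ideal.Quotient.mk_surjective,
    fun x => Ideal.Quotient.eq_zero_iff_mem, fun c => rfl⟩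

open PowerSeries in
theorem aux_step {K : Type u} [Field K] [CharZero K] {L : Type v} [Field L]
    [Algebra (LaurentSeries K) L] [FiniteDimensional (LaurentSeries K) L]
    (hodd : Odd (Module.finrank (LaurentSeries K) L)) :
    ∃ (O : ValuationSubring L) (L' : Type v) (_ : Field L') (_ : Algebra K L')
      (_ : FiniteDimensional K L') (ρ : O →+* L'), Odd (Module.finrank K L') ∧
      (∀ x : O, ρ x ≠ 0 → (x : L)⁻¹ ∈ O) ∧
      (∀ c : K, ∃ h : algebraMap (LaurentSeries K) L (algebraMap K (LaurentSeries K) c) ∈ O,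
        ρ ⟨_, h⟩ = algebraMap K L' c) ∧
      (∀ z : L, z ≠ 0 →
        algebraMap (LaurentSeries K) L (HahnSeries.single (1 : ℤ) (1 : K)) * z ^ 2 ∈ O →
        (algebraMap (LaurentSeries K) L (HahnSeries.single (1 : ℤ) (1 : K)) * z ^ 2)⁻¹ ∉ O) ∧
      (∀ x : O, ρ x ≠ 0 → (∃ r, r ^ 2 = ρ x) → ∃ r : L, r ^ 2 = x) := by
  let algAL : Algebra K⟦X⟧ L :=
    ((algebraMap (LaurentSeries K) L).comp (algebraMap K⟦X⟧ (LaurentSeries K))).toAlgebra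
  have tow : IsScalarTower K⟦X⟧ (LaurentSeries K) L := IsScalarTower.of_algebraMap_eq fun _ => rfl
  have : CharZero (LaurentSeries K) := charZero_of_injective_algebraMap
    (algebraMap K (LaurentSeries K)).injective
  have tf : FaithfulSMul K⟦X⟧ L := (faithfulSMul_iff_algebraMap_injective _ _).2
    ((algebraMap (LaurentSeries K) L).injective.comp (IsFractionRing.injective K⟦X⟧ (LaurentSeries K)))
  let B := integralClosure K⟦X⟧ L
  have fin : Module.Finite K⟦X⟧ B := IsIntegralClosure.finite K⟦X⟧ (LaurentSeries K) L B
  have free : Module.Free K⟦X⟧ B := IsIntegralClosure.module_free K⟦X⟧ (LaurentSeries K) L B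
  have ded : IsDedekindDomain B := IsIntegralClosure.isDedekindDomain K⟦X⟧ (LaurentSeries K) L B
  have frac : IsFractionRing B L := IsIntegralClosure.isFractionRing_of_finite_extension K⟦X⟧ (LaurentSeries K) L B
  let I : Ideal K⟦X⟧ := Ideal.span {X}
  have hI : I = IsLocalRing.maximalIdeal K⟦X⟧ := (maximalIdeal_eq_span_X).symm
  have Imax : I.IsMaximal := hI ▸ inferInstance
  have hI0 : I ≠ ⊥ := by
    simp [I, X_ne_zero]
  have : IsAdicComplete I K⟦X⟧ := inferInstanceAs (IsAdicComplete (Ideal.span {X}) K⟦X⟧)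
  have hens : HenselianRing B (I.map (algebraMap K⟦X⟧ B)) := aux_henselian I
  have hJ : I.map (algebraMap K⟦X⟧ B) ≠ ⊤ := by
    intro h
    have := HenselianRing.jac (R := B) (I := (I.map (algebraMap K⟦X⟧ B)))
    rw [h] at this
    have h1 := Ideal.mem_jacobson_bot.1 (this (Submodule.mem_top (x := (1 : B)))) (-1)
    simp at h1
  have art : IsArtinianRing (B ⧸ I.map (algebraMap K⟦X⟧ B)) := by
    let := Ideal.Quotient.field I
    exact IsArtinianRing.of_finite (K⟦X⟧ ⧸ I) _
  obtain ⟨loc, hnil⟩ := aux_local (I.map (algebraMap K⟦X⟧ B)) hJ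
  let P := IsLocalRing.maximalIdeal B
  have hlies : P.LiesOver I := by
    have : (P.comap (algebraMap K⟦X⟧ B)).IsMaximal := Ideal.isMaximal_comap_of_isIntegral_of_isMaximal P
    exact ⟨by rw [hI]; exact (IsLocalRing.eq_maximalIdeal this).symm⟩
  have hef := Ideal.ramificationIdx_mul_inertiaDeg_of_isLocalRing (S := B) (LaurentSeries K) L
    (p := I) hI0
  have hfodd : Odd (I.inertiaDeg' P) := by
    rw [← hef] at hodd
    exact (Nat.odd_mul.1 hodd).2
  have val : ValuationRing B := inferInstance
  let O : ValuationSubring L :=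
    { B.toSubring with
      mem_or_inv_mem' := by
        intro x
        rcases ValuationRing.isInteger_or_isInteger B x with ⟨y, hy⟩ | ⟨y, hy⟩
        · left
          rw [← hy]; exact y.2
        · right
          rw [← hy]; exact y.2 }
  have hO : ∀ x : L, x ∈ O ↔ x ∈ B := fun x => Iff.rfl
  obtain ⟨L', fL', algL', finL', ρ, hodd', hsurj, hker, hρ⟩ := aux_residue (K := K) (B := B) hfodd
  refine ⟨O, L', fL', algL', finL', ρ, hodd',
    ?_, ?_, ?_, ?_⟩
  · intro x hx
    have h1 : IsUnit (x : B) := by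
      by_contra h
      exact hx ((hker x).2 h)
    obtain ⟨y, hy⟩ := h1.exists_right_inv
    have h2 : (x : L) * (y : L) = 1 := congrArg Subtype.val hy
    rw [inv_eq_of_mul_eq_one_right h2]
    exact y.2
  · intro c
    exact ⟨(algebraMap K⟦X⟧ B (C c)).2, hρ c⟩
  · intro z hz h1 h2
    exact aux_odd_order hodd z hz h1 h2
  · rintro x hx ⟨r, hr⟩
    obtain ⟨y, rfl⟩ := hsurj r
    have h1 : IsUnit (x : B) := by
      by_contra h
      exact hx ((hker x).2 h)
    have h2 : IsUnit (2 : B) := by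
      have : IsUnit (algebraMap K⟦X⟧ B (C 2)) :=
        ((isUnit_iff_ne_zero.2 two_ne_zero).map C).map (algebraMap K⟦X⟧ B)
      rwa [map_ofNat, map_ofNat] at this
    have h3 : (x : B) - y ^ 2 ∈ P := by
      rw [← hker, map_sub, map_pow, sub_eq_zero]
      exact hr.symm
    obtain ⟨z, hz⟩ := aux_sqrt h2 (I.map (algebraMap K⟦X⟧ B)) hnil (x : B) y h1 h3
    exact ⟨z, congrArg Subtype.val hz⟩


theorem aux_charZero (k₀ : Type u) [Field k₀] [CharZero k₀] (n : ℕ) :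
    CharZero (IterLaurent k₀ n) :=
  charZero_of_injective_ringHom (iterLaurentEmb k₀ n).injective

theorem aux_var_castSucc (k₀ : Type u) [Field k₀] (n : ℕ) (i : Fin n) :
    iterLaurentVar k₀ (n + 1) i.castSucc = algebraMap (IterLaurent k₀ n)
      (LaurentSeries (IterLaurent k₀ n)) (iterLaurentVar k₀ n i) :=
  dif_pos i.2

theorem aux_var_last (k₀ : Type u) [Field k₀] (n : ℕ) :
    iterLaurentVar k₀ (n + 1) (Fin.last n) =
      (HahnSeries.single (1 : ℤ) (1 : IterLaurent k₀ n) : LaurentSeries (IterLaurent k₀ n)) :=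
  dif_neg (lt_irrefl n)

theorem aux_var_ne_zero (k₀ : Type u) [Field k₀] (n : ℕ) (i : Fin n) :
    iterLaurentVar k₀ n i ≠ 0 := by
  induction n with
  | zero => exact i.elim0
  | succ n ih =>
    refine Fin.lastCases ?_ (fun i => ?_) i
    · rw [aux_var_last]
      intro h0
      have : (HahnSeries.single (1 : ℤ) (1 : IterLaurent k₀ n) :
        LaurentSeries (IterLaurent k₀ n)) ≠ 0 := by simp
      exact this h0
    · rw [aux_var_castSucc]
      intro h0
      exact ih i ((map_eq_zero_iff (algebraMap (IterLaurent k₀ n)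
        (LaurentSeries (IterLaurent k₀ n))) (RingHom.injective _)).1 h0)

/-- The compositum of valuation subrings. -/
def auxComp {L : Type v} [Field L] (O : ValuationSubring L) {L' : Type v} [Field L']
    (ρ : O →+* L') (hρ : ∀ x : O, ρ x ≠ 0 → (x : L)⁻¹ ∈ O) (A' : ValuationSubring L') :
    ValuationSubring L where
  carrier := {x | ∃ h : x ∈ O, ρ ⟨x, h⟩ ∈ A'}
  mul_mem' := by
    rintro x y ⟨hx, hx'⟩ ⟨hy, hy'⟩
    refine ⟨mul_mem hx hy, ?_⟩
    have := mul_mem hx' hy'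
    rwa [← map_mul] at this
  one_mem' := ⟨one_mem _, by
    have : ρ ⟨1, one_mem _⟩ = 1 := map_one ρ
    rw [this]; exact one_mem _⟩
  add_mem' := by
    rintro x y ⟨hx, hx'⟩ ⟨hy, hy'⟩
    refine ⟨add_mem hx hy, ?_⟩
    have := add_mem hx' hy'
    rwa [← map_add] at this
  zero_mem' := ⟨zero_mem _, by
    have : ρ ⟨0, zero_mem _⟩ = 0 := map_zero ρ
    rw [this]; exact zero_mem _⟩
  neg_mem' := by
    rintro x ⟨hx, hx'⟩
    refine ⟨neg_mem hx, ?_⟩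
    have := neg_mem hx'
    rwa [← map_neg] at this
  mem_or_inv_mem' := by
    intro x
    by_cases hx0 : x = 0
    · left
      subst hx0
      refine ⟨zero_mem _, ?_⟩
      have : ρ ⟨0, zero_mem _⟩ = 0 := map_zero ρ
      rw [this]; exact zero_mem _
    have key : ∀ x : L, x ≠ 0 → x ∈ O → (∃ h : x ∈ O, ρ ⟨x, h⟩ ∈ A') ∨
        (∃ h : x⁻¹ ∈ O, ρ ⟨x⁻¹, h⟩ ∈ A') := by
      intro x hx0 h
      by_cases h0 : ρ ⟨x, h⟩ = 0
      · left; exact ⟨h, h0 ▸ zero_mem _⟩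
      · have h' := hρ _ h0
        have e : ρ ⟨x⁻¹, h'⟩ = (ρ ⟨x, h⟩)⁻¹ := by
          apply eq_inv_of_mul_eq_one_left
          rw [← map_mul, ← map_one ρ]
          congr 1
          exact Subtype.ext (inv_mul_cancel₀ hx0)
        rcases A'.mem_or_inv_mem (ρ ⟨x, h⟩) with h1 | h1
        · left; exact ⟨h, h1⟩
        · right; exact ⟨h', e ▸ h1⟩
    rcases O.mem_or_inv_mem x with h | h
    · exact key x hx0 h
    · have := key _ (inv_ne_zero hx0) h
      rw [inv_inv] at this
      exact this.symm

theorem auxComp_mem {L : Type v} [Field L] (O : ValuationSubring L) {L' : Type v} [Field L']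
    (ρ : O →+* L') (hρ : ∀ x : O, ρ x ≠ 0 → (x : L)⁻¹ ∈ O) (A' : ValuationSubring L') (x : L) :
    x ∈ auxComp O ρ hρ A' ↔ ∃ h : x ∈ O, ρ ⟨x, h⟩ ∈ A' := Iff.rfl

/-- Residue map of the compositum. -/
def auxCompRes {L : Type v} [Field L] (O : ValuationSubring L) {L' : Type v} [Field L']
    (ρ : O →+* L') (hρ : ∀ x : O, ρ x ≠ 0 → (x : L)⁻¹ ∈ O) (A' : ValuationSubring L')
    {F : Type v} [Field F] (ρ' : A' →+* F) : auxComp O ρ hρ A' →+* F where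
  toFun x := ρ' ⟨ρ ⟨x.1, x.2.1⟩, x.2.2⟩
  map_zero' := by
    rw [← map_zero ρ']; congr 1; exact Subtype.ext (map_zero ρ)
  map_one' := by
    rw [← map_one ρ']; congr 1; exact Subtype.ext (map_one ρ)
  map_add' x y := by
    rw [← map_add ρ']; congr 1; exact Subtype.ext (map_add ρ ⟨x.1, x.2.1⟩ ⟨y.1, y.2.1⟩)
  map_mul' x y := by
    rw [← map_mul ρ']; congr 1; exact Subtype.ext (map_mul ρ ⟨x.1, x.2.1⟩ ⟨y.1, y.2.1⟩)

theorem auxInv {L : Type v} [Field L] (O : ValuationSubring L) {L' : Type v} [Field L']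
    (ρ : O →+* L') (x : L) (hx0 : x ≠ 0) (h : x ∈ O) (h' : x⁻¹ ∈ O) :
    ρ ⟨x⁻¹, h'⟩ = (ρ ⟨x, h⟩)⁻¹ := by
  apply eq_inv_of_mul_eq_one_left
  rw [← map_mul, ← map_one ρ]
  congr 1
  exact Subtype.ext (inv_mul_cancel₀ hx0)

theorem aux_val (k₀ : Type u) [Field k₀] [CharZero k₀] (n : ℕ) :
    ∀ (L : Type v) [Field L] [Algebra (IterLaurent k₀ n) L]
    [FiniteDimensional (IterLaurent k₀ n) L]
    (_ : Odd (Module.finrank (IterLaurent k₀ n) L)),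
    ∃ (A : ValuationSubring L) (F : Type v) (_ : Field F) (_ : Algebra k₀ F)
      (_ : FiniteDimensional k₀ F) (ρ : A →+* F), Odd (Module.finrank k₀ F) ∧
      (∀ x : A, ρ x ≠ 0 → (x : L)⁻¹ ∈ A) ∧
      (∀ c : k₀, ∃ h : algebraMap (IterLaurent k₀ n) L (iterLaurentEmb k₀ n c) ∈ A,
        ρ ⟨_, h⟩ = algebraMap k₀ F c) ∧
      (∀ (c : Fin n → ℕ) (z : L), z ≠ 0 →
        (∏ i, algebraMap (IterLaurent k₀ n) L (iterLaurentVar k₀ n i) ^ c i) * z ^ 2 ∈ A →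
        ((∏ i, algebraMap (IterLaurent k₀ n) L (iterLaurentVar k₀ n i) ^ c i) * z ^ 2)⁻¹ ∈ A →
        ∀ i, Even (c i)) ∧
      (∀ x : A, ρ x ≠ 0 → (∃ r, r ^ 2 = ρ x) → ∃ r : L, r ^ 2 = x) := by
  induction n with
  | zero =>
    intro L _ algL fin hodd
    let i1 : Algebra k₀ L := algL
    have : FiniteDimensional k₀ L := fin
    refine ⟨⊤, L, inferInstance, i1, this, (⊤ : ValuationSubring L).subtype, hodd, fun _ _ => trivial,
      fun c => ⟨trivial, rfl⟩, fun _ _ _ _ _ i => i.elim0, ?_⟩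
    rintro x _ ⟨r, hr⟩
    exact ⟨r, hr⟩
  | succ n ih =>
    intro L _ algL fin hodd
    let K := IterLaurent k₀ n
    have := aux_charZero k₀ n
    let algL' : Algebra (LaurentSeries K) L := algL
    have fin' : FiniteDimensional (LaurentSeries K) L := fin
    obtain ⟨O, L', _, _, _, ρ, hodd', hρ, hc, hX, hsq⟩ := aux_step (K := K) (L := L) hodd
    obtain ⟨A', F, _, _, _, ρ', hodd'', hρ', hc', hX', hsq'⟩ := ih L' hodd'
    refine ⟨auxComp O ρ hρ A', F, inferInstance, inferInstance, inferInstance,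
      auxCompRes O ρ hρ A' ρ', hodd'', ?_, ?_, ?_, ?_⟩
    · intro x hx
      have h1 : ρ ⟨x.1, x.2.1⟩ ≠ 0 := by
        intro h
        apply hx
        have : ρ' ⟨ρ ⟨x.1, x.2.1⟩, x.2.2⟩ = 0 := by
          rw [← map_zero ρ']; congr 1; exact Subtype.ext h
        exact this
      have h2 := hρ _ h1
      have hx0 : x.1 ≠ 0 := by
        intro h; apply h1; rw [← map_zero ρ]; congr 1; exact Subtype.ext h
      refine ⟨h2, ?_⟩
      have h3 := hρ' ⟨ρ ⟨x.1, x.2.1⟩, x.2.2⟩ hx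
      rw [auxInv O ρ x.1 hx0 x.2.1 h2]
      exact h3
    · intro c
      obtain ⟨h1, h2⟩ := hc' c
      obtain ⟨h3, h4⟩ := hc (iterLaurentEmb k₀ n c)
      refine ⟨⟨h3, ?_⟩, ?_⟩
      · erw [h4]; exact h1
      · rw [← h2]
        change ρ' _ = ρ' _
        congr 1
        exact Subtype.ext h4
    · intro c z hz h1 h2
      have hs0 : (HahnSeries.single (1 : ℤ) (1 : K) : LaurentSeries K) ≠ 0 := by simp
      set φ : LaurentSeries K →+* L := algebraMap (LaurentSeries K) L with hφ
      set T : L := φ (HahnSeries.single (1 : ℤ) (1 : K)) with hT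
      have hT0 : T ≠ 0 := (map_ne_zero φ).2 hs0
      set κ : K := ∏ i, iterLaurentVar k₀ n i ^ c i.castSucc with hκ
      have hκ0 : κ ≠ 0 := Finset.prod_ne_zero_iff.2 fun i _ =>
        pow_ne_zero _ (aux_var_ne_zero k₀ n i)
      set κ' : L := φ (algebraMap K (LaurentSeries K) κ) with hκ'
      have hκ'0 : κ' ≠ 0 := (map_ne_zero φ).2 ((map_ne_zero _).2 hκ0)
      have e : (∏ i, algebraMap (IterLaurent k₀ (n + 1)) L (iterLaurentVar k₀ (n + 1) i) ^ c i)
          = κ' * T ^ c (Fin.last n) := by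
        rw [Fin.prod_univ_castSucc, hκ', hκ, map_prod, map_prod]
        congr 1
        · refine Finset.prod_congr rfl fun i _ => ?_
          rw [aux_var_castSucc, map_pow, map_pow]
          rfl
        · rw [aux_var_last]
          rfl
      rw [e] at h1 h2
      obtain ⟨hκO, hκρ⟩ := hc κ
      have hκρ0 : ρ ⟨_, hκO⟩ ≠ 0 := by
        rw [hκρ]; exact (map_ne_zero _).2 hκ0
      have hκO' := hρ _ hκρ0
      -- parity of the last exponent
      have hlast : Even (c (Fin.last n)) := by
        by_contra hc2
        rw [Nat.not_even_iff_odd] at hc2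
        obtain ⟨m, hm⟩ := hc2
        have e1 : T * (T ^ m * z) ^ 2 = κ'⁻¹ * (κ' * T ^ c (Fin.last n) * z ^ 2) := by
          rw [hm]; field_simp; ring
        have e2 : (T * (T ^ m * z) ^ 2)⁻¹ = κ' * (κ' * T ^ c (Fin.last n) * z ^ 2)⁻¹ := by
          rw [e1, mul_inv, inv_inv]
        refine hX (T ^ m * z) (mul_ne_zero (pow_ne_zero _ hT0) hz) ?_ ?_
        · exact e1 ▸ mul_mem hκO' h1.1
        · exact e2 ▸ mul_mem hκO h2.1
      obtain ⟨m, hm⟩ := hlast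
      set z' := T ^ m * z with hz'
      have hz'0 : z' ≠ 0 := mul_ne_zero (pow_ne_zero _ hT0) hz
      have e1 : κ' * T ^ c (Fin.last n) * z ^ 2 = κ' * z' ^ 2 := by
        rw [hm, hz']; ring
      rw [e1] at h1 h2
      have u1 : z' ^ 2 ∈ O := by
        have : z' ^ 2 = κ'⁻¹ * (κ' * z' ^ 2) := by field_simp
        exact this ▸ mul_mem hκO' h1.1
      have u2 : (z' ^ 2)⁻¹ ∈ O := by
        have : (z' ^ 2)⁻¹ = κ' * (κ' * z' ^ 2)⁻¹ := by field_simp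
        exact this ▸ mul_mem hκO h2.1
      have v1 : z' ∈ O := by
        rcases O.mem_or_inv_mem z' with h | h
        · exact h
        · have : z' = z' ^ 2 * z'⁻¹ := by field_simp
          exact this ▸ mul_mem u1 h
      have v2 : z'⁻¹ ∈ O := by
        have : z'⁻¹ = z' * (z' ^ 2)⁻¹ := by field_simp
        exact this ▸ mul_mem v1 u2
      set ζ := ρ ⟨z', v1⟩ with hζ
      have hζ0 : ζ ≠ 0 := by
        intro h
        have : ρ (⟨z', v1⟩ * ⟨z'⁻¹, v2⟩) = 1 := by
          rw [← map_one ρ]; congr 1; exact Subtype.ext (mul_inv_cancel₀ hz'0)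
        rw [map_mul, ← hζ, h, zero_mul] at this
        exact zero_ne_one this
      have e3 : ρ ⟨κ' * z' ^ 2, h1.1⟩ = (∏ i, algebraMap (IterLaurent k₀ n) L'
          (iterLaurentVar k₀ n i) ^ c i.castSucc) * ζ ^ 2 := by
        have : (⟨κ' * z' ^ 2, h1.1⟩ : O) = ⟨κ', hκO⟩ * ⟨z', v1⟩ ^ 2 := Subtype.ext rfl
        rw [this, map_mul, map_pow, hκρ, hκ, map_prod]
        simp only [map_pow]
        rfl
      have w1 := h1.2
      have w2 := h2.2
      rw [auxInv O ρ _ (mul_ne_zero hκ'0 (pow_ne_zero _ hz'0)) h1.1 h2.1] at w2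
      rw [e3] at w1 w2
      have fin := hX' (fun i => c i.castSucc) ζ hζ0 w1 w2
      intro i
      refine Fin.lastCases ?_ (fun i => ?_) i
      · exact ⟨m, hm⟩
      · exact fin i
    · rintro x hx hr
      obtain ⟨r, hr⟩ := hsq' ⟨ρ ⟨x.1, x.2.1⟩, x.2.2⟩ hx hr
      refine hsq ⟨x.1, x.2.1⟩ ?_ ⟨r, hr⟩
      intro h
      apply hx
      have : ρ' ⟨ρ ⟨x.1, x.2.1⟩, x.2.2⟩ = 0 := by
        rw [← map_zero ρ']; congr 1; exact Subtype.ext h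
      exact this


theorem aux_det_transfer {k : Type*} [Field k] {m : Type*} [Fintype m] [DecidableEq m]
    (a : k) (X Y : Matrix m m k) (hXY : X * Y = Y * X) :
    ∃ x' y' : k, (X * X - a • (Y * Y)).det = x' ^ 2 - a * y' ^ 2 := by
  obtain ⟨ω, hωdef⟩ : ∃ ω : QuadraticAlgebra k a 0, ω = ⟨0, 1⟩ := ⟨_, rfl⟩
  obtain ⟨ι, hι⟩ : ∃ ι : k →+* QuadraticAlgebra k a 0, ι = algebraMap k _ := ⟨_, rfl⟩
  have hω : ω * ω = ι a := by
    rw [hωdef, hι]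
    ext <;> simp
  obtain ⟨W, hW⟩ : ∃ W, W = ι.mapMatrix X + ω • ι.mapMatrix Y := ⟨_, rfl⟩
  obtain ⟨W', hW'⟩ : ∃ W, W = ι.mapMatrix X - ω • ι.mapMatrix Y := ⟨_, rfl⟩
  have hXY' : ι.mapMatrix X * ι.mapMatrix Y = ι.mapMatrix Y * ι.mapMatrix X := by
    rw [← map_mul, hXY, map_mul]
  have hWW : W * W' = ι.mapMatrix (X * X - a • (Y * Y)) := by
    have : ι.mapMatrix (a • (Y * Y)) = ι a • (ι.mapMatrix Y * ι.mapMatrix Y) := by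
      rw [← map_mul]
      ext1 i j
      simp only [RingHom.mapMatrix_apply, Matrix.map_apply, Matrix.smul_apply, smul_eq_mul]
      exact map_mul ι _ _
    rw [map_sub, map_mul, this, hW, hW', add_mul, mul_sub, mul_sub, smul_mul_assoc, mul_smul_comm,
      smul_mul_assoc, mul_smul_comm, smul_smul, hω, hXY']
    abel
  have hdet : W'.det = star W.det := by
    have h1 : star W.det = (starRingEnd (QuadraticAlgebra k a 0)) W.det := rfl
    rw [h1, RingHom.map_det]
    congr 1
    ext1 i j
    simp only [hW, hW', RingHom.mapMatrix_apply, Matrix.map_apply, Matrix.add_apply,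
      Matrix.sub_apply, Matrix.smul_apply, smul_eq_mul, starRingEnd_apply]
    rw [hωdef, hι]
    ext <;> simp
  have key : ι (X * X - a • (Y * Y)).det = W.det * star W.det := by
    rw [RingHom.map_det, ← hWW, Matrix.det_mul, hdet]
  refine ⟨W.det.re, W.det.im, ?_⟩
  have := congrArg QuadraticAlgebra.re key
  rw [hι, QuadraticAlgebra.algebraMap_re] at this
  rw [this]
  simp
  ring

theorem aux_norm_transfer (k F : Type*) [Field k] [Field F] [Algebra k F] [FiniteDimensional k F]
    (a : k) (x y : F) : ∃ x' y' : k,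
      Algebra.norm k (x ^ 2 - algebraMap k F a * y ^ 2) = x' ^ 2 - a * y' ^ 2 := by
  let b := Module.finBasis k F
  obtain ⟨x', y', h⟩ := aux_det_transfer a (Algebra.leftMulMatrix b x) (Algebra.leftMulMatrix b y)
    (by rw [← map_mul, ← map_mul, mul_comm])
  refine ⟨x', y', ?_⟩
  rw [← h, Algebra.norm_eq_matrix_det b]
  congr 1
  rw [← Algebra.smul_def, map_sub, map_smul, map_pow, map_pow, pow_two, pow_two]

theorem aux_sq_descent (k F : Type*) [Field k] [Field F] [Algebra k F] [FiniteDimensional k F]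
    (hodd : Odd (Module.finrank k F)) (a : k) (x : F) (hx : x ^ 2 = algebraMap k F a) :
    ∃ y : k, y ^ 2 = a := by
  by_cases ha : a = 0
  · exact ⟨0, by simp [ha]⟩
  obtain ⟨m, hm⟩ := hodd
  have h := congrArg (Algebra.norm k) hx
  rw [map_pow, Algebra.norm_algebraMap, hm] at h
  refine ⟨Algebra.norm k x / a ^ m, ?_⟩
  rw [div_pow, h]
  field_simp
  ring

/-- The norm of a quaternion. -/
def qN {R : Type*} [CommRing R] {a b : R} (z : ℍ[R,a,b]) : R :=
  z.re ^ 2 - a * z.imI ^ 2 - b * z.imJ ^ 2 + a * b * z.imK ^ 2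

theorem qN_mul {R : Type*} [CommRing R] {a b : R} (z w : ℍ[R,a,b]) : qN (z * w) = qN z * qN w := by
  simp [qN]; ring

theorem qN_star_mul {R : Type*} [CommRing R] {a b : R} (z : ℍ[R,a,b]) :
    star z * z = algebraMap R _ (qN z) := by
  rw [QuaternionAlgebra.algebraMap_eq]
  ext <;> simp [qN] <;> ring

theorem qN_mul_star {R : Type*} [CommRing R] {a b : R} (z : ℍ[R,a,b]) :
    z * star z = algebraMap R _ (qN z) := by
  rw [QuaternionAlgebra.algebraMap_eq]
  ext <;> simp [qN] <;> ring

theorem qN_aniso {k : Type*} [Field k] {c₁ c₂ : k}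
    (hdiv : ∀ z : ℍ[k,c₁,c₂], z ≠ 0 → IsUnit z) (z : ℍ[k,c₁,c₂]) (h : qN z = 0) : z = 0 := by
  by_contra hz
  have h1 := qN_star_mul z
  rw [h, map_zero] at h1
  have h2 := (hdiv z hz).mul_left_eq_zero.1 h1
  exact hz (by rw [← star_star z, h2, star_zero])

theorem aux_noZeroDiv {k : Type*} [Field k] {c₁ c₂ : k}
    (h : ∀ z : ℍ[k,c₁,c₂], qN z = 0 → z = 0) : NoZeroDivisors ℍ[k,c₁,c₂] where
  eq_zero_or_eq_zero_of_mul_eq_zero := by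
    intro x y hxy
    have := qN_mul x y
    rw [hxy] at this
    have h0 : qN (0 : ℍ[k,c₁,c₂]) = 0 := by simp [qN]
    rw [h0] at this
    rcases mul_eq_zero.1 this.symm with h' | h'
    · exact Or.inl (h _ h')
    · exact Or.inr (h _ h')

theorem aux_aniso_odd (k F : Type*) [Field k] [Field F] [Algebra k F]
    [FiniteDimensional k F] (hodd : Odd (Module.finrank k F)) {c₁ c₂ : k}
    (h : ∀ z : ℍ[k,c₁,c₂], qN z = 0 → z = 0)
    (z : ℍ[F,algebraMap k F c₁,algebraMap k F c₂]) (hz : qN z = 0) : z = 0 := by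
  have hc2 : c₂ ≠ 0 := by
    intro h0
    have := h ⟨0, 0, 1, 0⟩ (by simp [qN, h0])
    simpa using congrArg QuaternionAlgebra.imJ this
  have hc1 : ∀ x y : F, x ^ 2 - algebraMap k F c₁ * y ^ 2 = 0 → x = 0 ∧ y = 0 := by
    intro x y hxy
    by_cases hy : y = 0
    · subst hy
      simpa using hxy
    exfalso
    obtain ⟨s, hs⟩ := aux_sq_descent k F hodd c₁ (x / y) (by
      field_simp; linear_combination hxy)
    have := h ⟨s, 1, 0, 0⟩ (by simp [qN, hs])
    simpa using congrArg QuaternionAlgebra.imI this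
  have hz' : z.re ^ 2 - algebraMap k F c₁ * z.imI ^ 2 =
      algebraMap k F c₂ * (z.imJ ^ 2 - algebraMap k F c₁ * z.imK ^ 2) := by
    unfold qN at hz
    linear_combination hz
  by_cases hβ : z.imJ ^ 2 - algebraMap k F c₁ * z.imK ^ 2 = 0
  · rw [hβ, mul_zero] at hz'
    obtain ⟨h1, h2⟩ := hc1 _ _ hz'
    obtain ⟨h3, h4⟩ := hc1 _ _ hβ
    ext <;> simp [*]
  exfalso
  have hN := congrArg (Algebra.norm k) hz'
  obtain ⟨x, y, hxy⟩ := aux_norm_transfer k F c₁ z.re z.imI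
  obtain ⟨x', y', hxy'⟩ := aux_norm_transfer k F c₁ z.imJ z.imK
  rw [map_mul, Algebra.norm_algebraMap, hxy, hxy'] at hN
  obtain ⟨m, hm⟩ := hodd
  rw [hm] at hN
  have h0 := h ⟨x, y, c₂ ^ m * x', c₂ ^ m * y'⟩ (by
    simp only [qN]; linear_combination hN)
  have h1 := congrArg QuaternionAlgebra.imJ h0
  have h2 := congrArg QuaternionAlgebra.imK h0
  simp [hc2] at h1 h2
  have : Algebra.norm k (z.imJ ^ 2 - algebraMap k F c₁ * z.imK ^ 2) ≠ 0 := Algebra.norm_ne_zero_iff.2 hβ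
  exact this (by rw [hxy', h1, h2]; ring)

theorem aux_iso {k : Type*} [Field k] [CharZero k] {c₁ c₂ : k}
    (h : ∀ z : ℍ[k,c₁,c₂], qN z = 0 → z = 0) (q p : ℍ[k,c₁,c₂]) (a μ : k)
    (hq0 : q ≠ 0) (hp0 : p ≠ 0)
    (hq : q * q = algebraMap k _ a) (hp : p * p = algebraMap k _ μ) (hqp : p * q = - (q * p)) :
    Nonempty (ℍ[k,c₁,c₂] ≃ₐ[k] ℍ[k,a,μ]) := by
  have := aux_noZeroDiv h
  let B : QuaternionAlgebra.Basis ℍ[k,c₁,c₂] a 0 μ :=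
    { i := q, j := p, k := q * p
      i_mul_i := by rw [hq, zero_smul, add_zero, Algebra.algebraMap_eq_smul_one]
      j_mul_j := by rw [hp, Algebra.algebraMap_eq_smul_one]
      i_mul_j := rfl
      j_mul_i := by rw [hqp, zero_smul, zero_sub] }
  have two : (2 : k) ≠ 0 := two_ne_zero
  have key : ∀ α β : k, algebraMap k ℍ[k,c₁,c₂] α + β • q = 0 → α = 0 ∧ β = 0 := by
    intro α β h0
    have h1 : p * (algebraMap k ℍ[k,c₁,c₂] α + β • q) + (algebraMap k ℍ[k,c₁,c₂] α + β • q) * p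
        = (2 * α) • p := by
      rw [mul_add, add_mul, mul_smul_comm, hqp, smul_mul_assoc, ← Algebra.commutes, mul_smul, two_smul,
        ← Algebra.smul_def, smul_neg]
      abel
    rw [h0, mul_zero, zero_mul, add_zero] at h1
    have h2 : α = 0 := by
      rcases smul_eq_zero.1 h1.symm with h | h
      · simpa using h
      · exact absurd h hp0
    subst h2
    rw [map_zero, zero_add] at h0
    exact ⟨rfl, (smul_eq_zero.1 h0).resolve_right hq0⟩
  have inj : Function.Injective B.liftHom := by
    rw [injective_iff_map_eq_zero]
    intro x hx
    have hx' : algebraMap k ℍ[k,c₁,c₂] x.re + x.imI • q + x.imJ • p + x.imK • (q * p) = 0 := hx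
    obtain ⟨s, hs⟩ : ∃ s, s = algebraMap k ℍ[k,c₁,c₂] x.re + x.imI • q := ⟨_, rfl⟩
    obtain ⟨r, hr⟩ : ∃ r, r = algebraMap k ℍ[k,c₁,c₂] x.imJ + x.imK • q := ⟨_, rfl⟩
    have e : s + r * p = 0 := by
      rw [← hx', hr, hs, add_mul, ← Algebra.smul_def, smul_mul_assoc, ← add_assoc]
    have c1 : s * q = q * s := by
      rw [hs, add_mul, mul_add, Algebra.commutes, smul_mul_assoc, mul_smul_comm]
    have c2 : r * q = q * r := by
      rw [hr, add_mul, mul_add, Algebra.commutes, smul_mul_assoc, mul_smul_comm]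
    have e2 : (2 : k) • (q * s) = 0 := by
      have h1 : q * (s + r * p) + (s + r * p) * q = (2 : k) • (q * s) := by
        rw [mul_add, add_mul, c1, mul_assoc r, hqp, mul_neg, ← mul_assoc r, c2, ← mul_assoc, two_smul]
        abel
      rw [← h1, e]; simp
    have s0 : s = 0 := by
      rcases smul_eq_zero.1 e2 with h | h
      · exact absurd h two
      · exact (mul_eq_zero.1 h).resolve_left hq0
    rw [s0, zero_add] at e
    have r0 : r = 0 := (mul_eq_zero.1 e).resolve_right hp0
    obtain ⟨a1, a2⟩ := key _ _ (hs ▸ s0)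
    obtain ⟨a3, a4⟩ := key _ _ (hr ▸ r0)
    ext <;> simp [*]
  have bij : Function.Bijective B.liftHom := by
    refine ⟨inj, ?_⟩
    have := (LinearMap.injective_iff_surjective_of_finrank_eq_finrank (f := B.liftHom.toLinearMap)
      (by rw [QuaternionAlgebra.finrank_eq_four, QuaternionAlgebra.finrank_eq_four])).1 inj
    exact this
  exact ⟨(AlgEquiv.ofBijective B.liftHom bij).symm⟩


/-- Base change of quaternion algebras along a ring homomorphism. -/
def qmap {R S : Type*} [CommRing R] [CommRing S] (f : R →+* S) {a b : R} {a' b' : S}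
    (ha : f a = a') (hb : f b = b') : ℍ[R,a,b] →+* ℍ[S,a',b'] where
  toFun z := ⟨f z.re, f z.imI, f z.imJ, f z.imK⟩
  map_zero' := by ext <;> simp
  map_one' := by ext <;> simp
  map_add' x y := by ext <;> simp
  map_mul' x y := by ext <;> simp [← ha, ← hb]

theorem qmap_star {R S : Type*} [CommRing R] [CommRing S] (f : R →+* S) {a b : R} {a' b' : S}
    (ha : f a = a') (hb : f b = b') (z : ℍ[R,a,b]) :
    qmap f ha hb (star z) = star (qmap f ha hb z) := by
  ext <;> simp [qmap]

theorem qmap_qN {R S : Type*} [CommRing R] [CommRing S] (f : R →+* S) {a b : R} {a' b' : S}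
    (ha : f a = a') (hb : f b = b') (z : ℍ[R,a,b]) :
    qN (qmap f ha hb z) = f (qN z) := by
  simp [qmap, qN, ← ha, ← hb]

theorem qmap_algebraMap {R S : Type*} [CommRing R] [CommRing S] (f : R →+* S) {a b : R} {a' b' : S}
    (ha : f a = a') (hb : f b = b') (x : R) :
    qmap f ha hb (algebraMap R _ x) = algebraMap S _ (f x) := by
  rw [QuaternionAlgebra.algebraMap_eq, QuaternionAlgebra.algebraMap_eq]
  ext <;> simp [qmap]

theorem qN_of_pure {k : Type*} [Field k] {c₁ c₂ : k} (q : ℍ[k,c₁,c₂]) (hq : star q = - q) (a : k)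
    (ha : q * q = algebraMap k _ a) : qN q = - a := by
  have := qN_star_mul q
  rw [hq, neg_mul, ha, ← map_neg] at this
  exact (QuaternionAlgebra.algebraMap_injective this).symm

theorem aux_exists_anti {k : Type*} [Field k] [CharZero k] {c₁ c₂ : k}
    (h : ∀ z : ℍ[k,c₁,c₂], qN z = 0 → z = 0) (q : ℍ[k,c₁,c₂]) (hq : star q = - q) :
    ∃ r : ℍ[k,c₁,c₂], r ≠ 0 ∧ star r = - r ∧ r * q = - (q * r) := by
  have hc2 : c₂ ≠ 0 := by
    intro h0
    have := h ⟨0, 0, 1, 0⟩ (by simp [qN, h0])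
    simpa using congrArg QuaternionAlgebra.imJ this
  have hc1 : c₁ ≠ 0 := by
    intro h0
    have := h ⟨0, 1, 0, 0⟩ (by simp [qN, h0])
    simpa using congrArg QuaternionAlgebra.imI this
  have hre : q.re = 0 := QuaternionAlgebra.star_eq_neg.1 hq
  by_cases h1 : q.imI = 0 ∧ q.imJ = 0
  · refine ⟨⟨0, 1, 0, 0⟩, ?_, ?_, ?_⟩
    · intro h0
      simpa using congrArg QuaternionAlgebra.imI h0
    · ext <;> simp
    · ext <;> simp [h1, hre]
  · refine ⟨⟨0, c₂ * q.imJ, - (c₁ * q.imI), 0⟩, ?_, ?_, ?_⟩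
    · intro h0
      have e1 := congrArg QuaternionAlgebra.imI h0
      have e2 := congrArg QuaternionAlgebra.imJ h0
      simp [hc1, hc2] at e1 e2
      exact h1 ⟨e2, e1⟩
    · ext <;> simp
    · ext <;> simp [hre] <;> ring

theorem aux_commute {k : Type*} [Field k] [CharZero k] {c₁ c₂ : k} (q : ℍ[k,c₁,c₂])
    (hq : star q = - q) (a : k) (ha0 : a ≠ 0) (ha : q * q = algebraMap k _ a)
    (e : ℍ[k,c₁,c₂]) (he : e * q = q * e) : ∃ α β : k, qN e = α ^ 2 - a * β ^ 2 := by
  have hre : q.re = 0 := QuaternionAlgebra.star_eq_neg.1 hq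
  obtain ⟨p, hp⟩ : ∃ p, p = e - algebraMap k _ e.re := ⟨_, rfl⟩
  have hpre : star p = - p := by
    rw [QuaternionAlgebra.star_eq_neg, hp, QuaternionAlgebra.algebraMap_eq]
    simp
  have hpq : p * q = q * p := by
    rw [hp, sub_mul, mul_sub, he, Algebra.commutes]
  have hs : star (p * q) = p * q := by
    rw [star_mul, hq, hpre, neg_mul_neg, hpq]
  rw [QuaternionAlgebra.star_eq_self] at hs
  have h1 : a • p = (p * q).re • q := by
    have h2 : p * q * q = a • p := by
      rw [mul_assoc, ha, ← Algebra.commutes, Algebra.smul_def]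
    rw [← h2]
    nth_rewrite 1 [hs]
    rw [QuaternionAlgebra.coe_mul_eq_smul]
  obtain ⟨s, hsdef⟩ : ∃ s, s = (p * q).re := ⟨_, rfl⟩
  rw [← hsdef] at h1
  have h2 : p = (s / a) • q := by
    rw [div_eq_inv_mul, mul_smul, ← h1, smul_smul, inv_mul_cancel₀ ha0, one_smul]
  have h3 : e = algebraMap k _ e.re + (s / a) • q := by rw [← h2, hp]; abel
  have h4 := qN_of_pure q hq a ha
  refine ⟨e.re, s / a, ?_⟩
  rw [h3, QuaternionAlgebra.algebraMap_eq]
  simp only [qN, hre] at h4 ⊢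
  simp [hre]
  linear_combination (s / a) ^ 2 * h4

theorem aux_slot {k F : Type*} [Field k] [CharZero k] [Field F] [Algebra k F]
    [FiniteDimensional k F] (hodd : Odd (Module.finrank k F)) {c₁ c₂ : k}
    (h : ∀ z : ℍ[k,c₁,c₂], qN z = 0 → z = 0)
    (q : ℍ[k,c₁,c₂]) (hq : star q = - q) (hq0 : q ≠ 0) (a : k) (ha : q * q = algebraMap k _ a)
    (u : F) (hu : ¬ ∃ r, r ^ 2 = u)
    (y : ℍ[F,algebraMap k F c₁,algebraMap k F c₂]) (hy : y * y = algebraMap F _ u)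
    (hyq : star y * qmap (algebraMap k F) rfl rfl q = qmap (algebraMap k F) rfl rfl q * y) :
    Nonempty (ℍ[k,c₁,c₂] ≃ₐ[k] ℍ[k,a,Algebra.norm k u]) := by
  have : CharZero F := charZero_of_injective_algebraMap (algebraMap k F).injective
  have nzd := aux_noZeroDiv h
  have ha0 : a ≠ 0 := by
    rintro rfl
    rw [map_zero] at ha
    exact hq0 (mul_self_eq_zero.1 ha)
  have hu0 : u ≠ 0 := by
    rintro rfl
    exact hu ⟨0, by simp⟩
  have hN0 : Algebra.norm k u ≠ 0 := Algebra.norm_ne_zero_iff.2 hu0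
  -- `y` is pure
  have hy1 : y.re = 0 := by
    by_contra h0
    rw [QuaternionAlgebra.algebraMap_eq] at hy
    have e0 := congrArg QuaternionAlgebra.re hy
    have e1 := congrArg QuaternionAlgebra.imI hy
    have e2 := congrArg QuaternionAlgebra.imJ hy
    have e3 := congrArg QuaternionAlgebra.imK hy
    simp at e0 e1 e2 e3
    have f1 : y.imI = 0 := by
      have : 2 * y.re * y.imI = 0 := by linear_combination e1
      simpa [h0] using this
    have f2 : y.imJ = 0 := by
      have : 2 * y.re * y.imJ = 0 := by linear_combination e2
      simpa [h0] using this
    have f3 : y.imK = 0 := by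
      have : 2 * y.re * y.imK = 0 := by linear_combination e3
      simpa [h0] using this
    exact hu ⟨y.re, by rw [f1, f2, f3] at e0; linear_combination e0⟩
  have hy2 : star y = - y := QuaternionAlgebra.star_eq_neg.2 hy1
  rw [hy2] at hyq
  obtain ⟨r, hr0, hrpure, hrq⟩ := aux_exists_anti h q hq
  set Φ := qmap (algebraMap k F) (a := c₁) (b := c₂) rfl rfl with hΦ
  obtain ⟨b, hb⟩ : ∃ b, b = - qN r := ⟨_, rfl⟩
  have hb0 : b ≠ 0 := by
    rw [hb, neg_ne_zero]
    exact fun h0 => hr0 (h r h0)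
  have hrr : r * r = algebraMap k _ b := by
    have := qN_star_mul r
    rw [hrpure] at this
    rw [hb, map_neg, ← this, neg_mul, neg_neg]
  have hcomm : (Φ r * y) * Φ q = Φ q * (Φ r * y) := by
    have e1 : y * Φ q = - (Φ q * y) := by rw [← hyq, neg_mul, neg_neg]
    have e2 : Φ r * Φ q = - (Φ q * Φ r) := by rw [← map_mul, hrq, map_neg, map_mul]
    rw [mul_assoc, e1, mul_neg, ← mul_assoc, e2, neg_mul, neg_neg, mul_assoc]
  have hq' : star (Φ q) = - Φ q := by rw [← qmap_star, hq, map_neg]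
  obtain ⟨α, β, hαβ⟩ := aux_commute (Φ q) hq' (algebraMap k F a) ((map_ne_zero _).2 ha0)
    (by rw [← map_mul, ha, qmap_algebraMap]) _ hcomm
  rw [qN_mul, qmap_qN, qN_of_pure y hy2 u hy, mul_neg, ← neg_mul, ← map_neg, ← hb] at hαβ
  have hbF : algebraMap k F b ≠ 0 := (map_ne_zero _).2 hb0
  have hu' : u = algebraMap k F b * ((α / algebraMap k F b) ^ 2 -
      algebraMap k F a * (β / algebraMap k F b) ^ 2) := by
    field_simp
    linear_combination hαβ
  obtain ⟨x', y', hxy⟩ := aux_norm_transfer k F a (α / algebraMap k F b) (β / algebraMap k F b)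
  have hNu := congrArg (Algebra.norm k) hu'
  obtain ⟨m, hm⟩ := hodd
  rw [map_mul, hxy, Algebra.norm_algebraMap, hm] at hNu
  obtain ⟨X, hX⟩ : ∃ X, X = b ^ m * x' := ⟨_, rfl⟩
  obtain ⟨Y, hY⟩ : ∃ Y, Y = b ^ m * y' := ⟨_, rfl⟩
  have hμ : Algebra.norm k u = b * (X ^ 2 - a * Y ^ 2) := by
    rw [hNu, hX, hY]; ring
  obtain ⟨s, hs⟩ : ∃ s, s = algebraMap k ℍ[k,c₁,c₂] X + Y • q := ⟨_, rfl⟩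
  obtain ⟨s', hs'⟩ : ∃ s, s = algebraMap k ℍ[k,c₁,c₂] X - Y • q := ⟨_, rfl⟩
  have hsr : s * r = r * s' := by
    rw [hs, hs', add_mul, mul_sub, Algebra.commutes, smul_mul_assoc, mul_smul_comm, hrq, smul_neg,
      sub_neg_eq_add]
  have hss : s' * s = algebraMap k _ (X ^ 2 - a * Y ^ 2) := by
    have ha' : q * q = a • (1 : ℍ[k,c₁,c₂]) := by rw [ha, Algebra.algebraMap_eq_smul_one]
    simp only [hs, hs', Algebra.algebraMap_eq_smul_one, sub_mul, mul_add, smul_mul_assoc,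
      mul_smul_comm, ha', one_mul, mul_one, smul_smul]
    module
  have hsq : s * q = q * s := by
    rw [hs, add_mul, mul_add, Algebra.commutes, smul_mul_assoc, mul_smul_comm]
  have hpp : (r * s) * (r * s) = algebraMap k _ (Algebra.norm k u) := by
    rw [mul_assoc, ← mul_assoc s, hsr, mul_assoc r s', hss, ← mul_assoc, hrr, hμ, map_mul]
  refine aux_iso h q (r * s) a _ hq0 ?_ ha hpp ?_
  · intro h0
    rw [h0, mul_zero] at hpp
    apply hN0
    apply QuaternionAlgebra.algebraMap_injective (c₁ := c₁) (c₂ := 0) (c₃ := c₂)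
    rw [← hpp, map_zero]
  · rw [mul_assoc, hsq, ← mul_assoc, hrq, neg_mul, mul_assoc]


theorem aux_sim {k F : Type*} [Field k] [CharZero k] [Field F] [Algebra k F]
    [FiniteDimensional k F] (hodd : Odd (Module.finrank k F)) {c₁ c₂ : k}
    (h : ∀ z : ℍ[k,c₁,c₂], qN z = 0 → z = 0)
    (q₀ q₁ : ℍ[k,c₁,c₂]) (hq₀ : star q₀ = - q₀) (hq₀0 : q₀ ≠ 0) (a₀ : k)
    (ha₀ : q₀ * q₀ = algebraMap k _ a₀)
    (hq₁ : star q₁ = - q₁) (hq₁0 : q₁ ≠ 0) (a₁ : k) (ha₁ : q₁ * q₁ = algebraMap k _ a₁)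
    (u : F) (hu : u ≠ 0)
    (y : ℍ[F,algebraMap k F c₁,algebraMap k F c₂])
    (hy : star y * qmap (algebraMap k F) rfl rfl q₁ * y =
      algebraMap F _ u * qmap (algebraMap k F) rfl rfl q₀) :
    ∃ (lam : k) (c : ℍ[k,c₁,c₂]), lam ≠ 0 ∧ c ≠ 0 ∧ q₁ = lam • (star c * q₀ * c) := by
  have nzd := aux_noZeroDiv h
  have ha₀0 : a₀ ≠ 0 := by
    rintro rfl
    rw [map_zero] at ha₀
    exact hq₀0 (mul_self_eq_zero.1 ha₀)
  have ha₁0 : a₁ ≠ 0 := by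
    rintro rfl
    rw [map_zero] at ha₁
    exact hq₁0 (mul_self_eq_zero.1 ha₁)
  have hN := congrArg qN hy
  have hst : qN (star y) = qN y := by simp [qN]
  have halg : qN (algebraMap F ℍ[F,algebraMap k F c₁,algebraMap k F c₂] u) = u ^ 2 := by
    rw [QuaternionAlgebra.algebraMap_eq]; simp [qN]
  rw [qN_mul, qN_mul, qN_mul, qmap_qN, qmap_qN, qN_of_pure q₀ hq₀ a₀ ha₀, qN_of_pure q₁ hq₁ a₁ ha₁,
    hst, halg, map_neg, map_neg] at hN
  have ha₁F : algebraMap k F a₁ ≠ 0 := (map_ne_zero _).2 ha₁0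
  obtain ⟨s, hs⟩ := aux_sq_descent k F hodd (a₀ / a₁) (qN y / u) (by
    rw [map_div₀]
    field_simp
    linear_combination - hN)
  have hs0 : s ≠ 0 := by
    rintro rfl
    rw [zero_pow two_ne_zero] at hs
    exact div_ne_zero ha₀0 ha₁0 hs.symm
  by_cases hc : q₀ + s • q₁ = 0
  · refine ⟨- s⁻¹, 1, neg_ne_zero.2 (inv_ne_zero hs0), one_ne_zero, ?_⟩
    rw [star_one, one_mul, mul_one, eq_neg_of_add_eq_zero_left hc, smul_neg, neg_smul, neg_neg,
      smul_smul, inv_mul_cancel₀ hs0, one_smul]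
  · obtain ⟨c, hcdef⟩ : ∃ c, c = q₀ + s • q₁ := ⟨_, rfl⟩
    rw [← hcdef] at hc
    have hNc : qN c ≠ 0 := fun h0 => hc (h c h0)
    have e1 : q₀ * c = c * (s • q₁) := by
      rw [hcdef, mul_add, add_mul, ha₀, smul_mul_assoc, mul_smul_comm s q₁, smul_smul, ha₁,
        ← pow_two, hs, Algebra.smul_def (a₀ / a₁), ← map_mul,
        div_mul_cancel₀ _ ha₁0, add_comm]
    refine ⟨(qN c * s)⁻¹, c, inv_ne_zero (mul_ne_zero hNc hs0), hc, ?_⟩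
    rw [mul_assoc, e1, ← mul_assoc, qN_star_mul, ← Algebra.smul_def, smul_smul, smul_smul,
      mul_assoc, inv_mul_cancel₀ (mul_ne_zero hNc hs0), one_smul]

/-- The maximum of the valuations of the components. -/
def auxw {L : Type*} [Field L] (A : ValuationSubring L) {c₁ c₂ : L} (z : ℍ[L,c₁,c₂]) :
    A.ValueGroup :=
  max (max (A.valuation z.re) (A.valuation z.imI)) (max (A.valuation z.imJ) (A.valuation z.imK))

theorem auxw_smul {L : Type*} [Field L] (A : ValuationSubring L) {c₁ c₂ : L} (x : L)
    (z : ℍ[L,c₁,c₂]) : auxw A (x • z) = A.valuation x * auxw A z := by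
  have hm : ∀ a b c : A.ValueGroup, a * max b c = max (a * b) (a * c) := fun a b c =>
    Monotone.map_max (f := fun x => a * x) (fun _ _ h => mul_le_mul' le_rfl h)
  simp only [auxw, hm]
  simp

theorem auxw_exists {L : Type*} [Field L] (A : ValuationSubring L) {c₁ c₂ : L}
    (z : ℍ[L,c₁,c₂]) : ∃ x, A.valuation x = auxw A z := by
  unfold auxw
  rcases max_choice (max (A.valuation z.re) (A.valuation z.imI))
    (max (A.valuation z.imJ) (A.valuation z.imK)) with h | h <;> rw [h]
  · rcases max_choice (A.valuation z.re) (A.valuation z.imI) with h | h <;> exact ⟨_, h.symm⟩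
  · rcases max_choice (A.valuation z.imJ) (A.valuation z.imK) with h | h <;> exact ⟨_, h.symm⟩

theorem auxw_lt {L F : Type*} [Field L] [Field F] (A : ValuationSubring L) (ρ : A →+* F)
    (hρ : ∀ x : A, ρ x ≠ 0 → (x : L)⁻¹ ∈ A) (x : A) : A.valuation (x : L) < 1 ↔ ρ x = 0 := by
  constructor
  · intro h
    by_contra h0
    have h1 := hρ x h0
    have hx0 : (x : L) ≠ 0 := by
      intro h; apply h0
      have : x = 0 := Subtype.ext h
      rw [this, map_zero]
    have h2 := (A.valuation_le_one_iff _).2 h1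
    have h3 : A.valuation (x : L) * A.valuation (x : L)⁻¹ = 1 := by
      rw [← map_mul, mul_inv_cancel₀ hx0, map_one]
    have := mul_lt_mul'' h (lt_of_le_of_ne h2 ?_) zero_le zero_le
    · rw [h3, one_mul] at this; exact lt_irrefl _ this
    · intro h4
      rw [h4, mul_one] at h3
      exact h.ne h3
  · intro h
    refine lt_of_le_of_ne ((A.valuation_le_one_iff _).2 x.2) fun h1 => ?_
    have hx0 : (x : L) ≠ 0 := by
      intro h; rw [h, map_zero] at h1; exact zero_ne_one h1
    have h2 : (x : L)⁻¹ ∈ A := by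
      rw [← A.valuation_le_one_iff, map_inv₀, h1, inv_one]
    have h3 : x * ⟨_, h2⟩ = 1 := Subtype.ext (mul_inv_cancel₀ hx0)
    have := congrArg ρ h3
    rw [map_mul, h, zero_mul, map_one] at this
    exact zero_ne_one this

/-- Inclusion of integral quaternions. -/
def auxι {L : Type*} [Field L] (A : ValuationSubring L) (c₁ c₂ : A) :
    ℍ[A,c₁,c₂] →+* ℍ[L,(c₁ : L),(c₂ : L)] :=
  qmap A.subtype (a' := (c₁ : L)) (b' := (c₂ : L)) rfl rfl

theorem auxw_res {L F : Type*} [Field L] [Field F] (A : ValuationSubring L) (ρ : A →+* F)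
    (hρ : ∀ x : A, ρ x ≠ 0 → (x : L)⁻¹ ∈ A) (c₁ c₂ : A) (c₁' c₂' : F) (h₁ : ρ c₁ = c₁')
    (h₂ : ρ c₂ = c₂') (Z : ℍ[A,c₁,c₂]) :
    auxw A (auxι A c₁ c₂ Z) < 1 ↔
      qmap ρ h₁ h₂ Z = 0 := by
  simp only [auxw, max_lt_iff]
  have := auxw_lt A ρ hρ
  constructor
  · rintro ⟨⟨a, b⟩, c, d⟩
    ext
    · exact (this _).1 a
    · exact (this _).1 b
    · exact (this _).1 c
    · exact (this _).1 d
  · intro h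
    exact ⟨⟨(this _).2 (congrArg QuaternionAlgebra.re h), (this _).2 (congrArg QuaternionAlgebra.imI h)⟩,
      (this _).2 (congrArg QuaternionAlgebra.imJ h), (this _).2 (congrArg QuaternionAlgebra.imK h)⟩

theorem auxw_le {L : Type*} [Field L] (A : ValuationSubring L) (c₁ c₂ : A) (Z : ℍ[A,c₁,c₂]) :
    auxw A (auxι A c₁ c₂ Z) ≤ 1 := by
  simp only [auxw, max_le_iff]
  exact ⟨⟨(A.valuation_le_one_iff _).2 (Subtype.prop _), (A.valuation_le_one_iff _).2 (Subtype.prop _)⟩,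
    (A.valuation_le_one_iff _).2 (Subtype.prop _), (A.valuation_le_one_iff _).2 (Subtype.prop _)⟩

theorem auxw_lift {L : Type*} [Field L] (A : ValuationSubring L) (c₁ c₂ : A)
    (z : ℍ[L,(c₁ : L),(c₂ : L)]) (hz : auxw A z ≤ 1) :
    ∃ Z : ℍ[A,c₁,c₂], auxι A c₁ c₂ Z = z := by
  simp only [auxw, max_le_iff, A.valuation_le_one_iff] at hz
  exact ⟨⟨⟨_, hz.1.1⟩, ⟨_, hz.1.2⟩, ⟨_, hz.2.1⟩, ⟨_, hz.2.2⟩⟩, rfl⟩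

theorem auxw_zero {L : Type*} [Field L] (A : ValuationSubring L) {c₁ c₂ : L}
    (z : ℍ[L,c₁,c₂]) : auxw A z = 0 ↔ z = 0 := by
  constructor
  · intro h
    have h' : auxw A z ≤ 0 := h.le
    unfold auxw at h'
    rw [max_le_iff, max_le_iff, max_le_iff] at h'
    simp only [le_zero_iff, map_eq_zero] at h'
    ext <;> simp [h']
  · rintro rfl
    simp [auxw]

theorem auxw_mul {L F : Type*} [Field L] [Field F] (A : ValuationSubring L) (ρ : A →+* F)
    (hρ : ∀ x : A, ρ x ≠ 0 → (x : L)⁻¹ ∈ A) (c₁ c₂ : A) (c₁' c₂' : F) (h₁ : ρ c₁ = c₁')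
    (h₂ : ρ c₂ = c₂') [NoZeroDivisors ℍ[F,c₁',c₂']] (z z' : ℍ[L,(c₁ : L),(c₂ : L)]) :
    auxw A (z * z') = auxw A z * auxw A z' := by
  by_cases hz : z = 0
  · rw [hz, zero_mul, (auxw_zero A _).2 rfl, zero_mul]
  by_cases hz' : z' = 0
  · rw [hz', mul_zero, (auxw_zero A _).2 rfl, mul_zero]
  have key : ∀ z : ℍ[L,(c₁ : L),(c₂ : L)], z ≠ 0 → ∃ (x : L) (Z : ℍ[A,c₁,c₂]),
      A.valuation x = auxw A z ∧ x • auxι A c₁ c₂ Z = z ∧ qmap ρ h₁ h₂ Z ≠ 0 := by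
    intro z hz
    obtain ⟨x, hx⟩ := auxw_exists A z
    have hx0 : x ≠ 0 := by
      rintro rfl
      rw [map_zero] at hx
      exact hz ((auxw_zero A z).1 hx.symm)
    have h1 : auxw A (x⁻¹ • z) = 1 := by
      rw [auxw_smul, ← hx, ← map_mul, inv_mul_cancel₀ hx0, map_one]
    obtain ⟨Z, hZ⟩ := auxw_lift A c₁ c₂ (x⁻¹ • z) h1.le
    refine ⟨x, Z, hx, ?_, ?_⟩
    · rw [hZ, smul_smul, mul_inv_cancel₀ hx0, one_smul]
    · intro h
      have := (auxw_res A ρ hρ c₁ c₂ c₁' c₂' h₁ h₂ Z).2 h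
      rw [hZ, h1] at this
      exact lt_irrefl _ this
  obtain ⟨x, Z, hx, hZ, hZ0⟩ := key z hz
  obtain ⟨x', Z', hx', hZ', hZ0'⟩ := key z' hz'
  have h3 : auxw A (auxι A c₁ c₂ (Z * Z')) = 1 := by
    refine le_antisymm (auxw_le A c₁ c₂ _) (not_lt.1 fun h => ?_)
    rw [auxw_res A ρ hρ c₁ c₂ c₁' c₂' h₁ h₂, map_mul] at h
    exact mul_ne_zero hZ0 hZ0' h
  have h4 : z * z' = (x * x') • auxι A c₁ c₂ (Z * Z') := by
    rw [map_mul, mul_smul, ← mul_smul_comm, ← smul_mul_assoc, hZ, hZ']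
  rw [h4, auxw_smul, h3, mul_one, map_mul, hx, hx']

theorem aux_qval {L F : Type*} [Field L] [Field F] (A : ValuationSubring L) (ρ : A →+* F)
    (hρ : ∀ x : A, ρ x ≠ 0 → (x : L)⁻¹ ∈ A) (c₁ c₂ : A) (c₁' c₂' : F) (h₁ : ρ c₁ = c₁')
    (h₂ : ρ c₂ = c₂') (nzd : NoZeroDivisors ℍ[F,c₁',c₂']) :
    ∃ w : Valuation ℍ[L,(c₁ : L),(c₂ : L)] A.ValueGroup, ∀ z, w z = auxw A z := by
  refine ⟨{ toFun := auxw A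
            map_zero' := (auxw_zero A _).2 rfl
            map_one' := ?_
            map_mul' := auxw_mul A ρ hρ c₁ c₂ c₁' c₂' h₁ h₂
            map_add_le_max' := ?_ }, fun z => rfl⟩
  · simp [auxw]
  · intro x y
    have key : ∀ a b c d e f g h : A.ValueGroup, max (max (max a b) (max c d)) (max (max e f) (max g h))
        = max (max (max a e) (max b f)) (max (max c g) (max d h)) := by
      intro a b c d e f g h
      simp only [max_comm, max_left_comm]
    unfold auxw
    rw [key]
    exact max_le_max (max_le_max (A.valuation.map_add _ _) (A.valuation.map_add _ _))
      (max_le_max (A.valuation.map_add _ _) (A.valuation.map_add _ _))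

theorem auxw_star {L : Type*} [Field L] (A : ValuationSubring L) {c₁ c₂ : L}
    (z : ℍ[L,c₁,c₂]) : auxw A (star z) = auxw A z := by
  simp [auxw, Valuation.map_neg]

theorem auxw_algebraMap {L : Type*} [Field L] (A : ValuationSubring L) {c₁ c₂ : L}
    (x : L) : auxw A (algebraMap L ℍ[L,c₁,c₂] x) = A.valuation x := by
  rw [QuaternionAlgebra.algebraMap_eq]
  simp [auxw]

theorem aux_val_sum {R Γ ι : Type*} [Ring R] [LinearOrderedCommGroupWithZero Γ] [Fintype ι]
    (w : Valuation R Γ) (t : ι → R) (s : R) (hs : w s ≠ 0) (hsum : ∑ i, t i = s)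
    (hdist : ∀ i j, i ≠ j → w (t i) ≠ 0 → w (t i) ≠ w (t j)) :
    ∃ i, w (t i) = w s ∧ w (t i - s) < w s := by
  classical
  have hne : Nonempty ι := by
    by_contra h
    rw [not_nonempty_iff] at h
    rw [Finset.univ_eq_empty, Finset.sum_empty] at hsum
    rw [← hsum, map_zero] at hs
    exact hs rfl
  obtain ⟨i, hi⟩ := Finite.exists_max (fun i => w (t i))
  have hi0 : w (t i) ≠ 0 := by
    intro h0
    have h1 : w (∑ i, t i) ≤ 0 := w.map_sum_le fun j _ => (hi j).trans h0.le
    rw [hsum] at h1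
    exact hs (le_zero_iff.1 h1)
  have hrest : w (∑ j ∈ Finset.univ.erase i, t j) < w (t i) := by
    refine w.map_sum_lt hi0 fun j hj => lt_of_le_of_ne (hi j) ?_
    exact fun h => hdist i j (Finset.ne_of_mem_erase hj).symm hi0 h.symm
  have hsplit : t i + ∑ j ∈ Finset.univ.erase i, t j = s := by
    rw [← hsum, Finset.add_sum_erase _ _ (Finset.mem_univ i)]
  have hw : w s = w (t i) := by
    rw [← hsplit, w.map_add_eq_of_lt_left hrest]
  refine ⟨i, hw.symm, ?_⟩
  rw [hw, ← hsplit, sub_add_cancel_left, w.map_neg]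
  exact hrest


/-- Extension of scalars to the big field. -/
def auxQ {k₀ L : Type*} [Field k₀] [Field L] (A : ValuationSubring L) (fA : k₀ →+* A)
    (c₁ c₂ : k₀) (q : ℍ[k₀,c₁,c₂]) : ℍ[L,(fA c₁ : L),(fA c₂ : L)] :=
  auxι A (fA c₁) (fA c₂) (qmap fA rfl rfl q)

theorem auxQ_res {k₀ L F : Type*} [Field k₀] [Field L] [Field F] [Algebra k₀ F]
    (A : ValuationSubring L) (ρ : A →+* F) (fA : k₀ →+* A)
    (hfA : ∀ c, ρ (fA c) = algebraMap k₀ F c) (c₁ c₂ : k₀) (q : ℍ[k₀,c₁,c₂]) :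
    qmap ρ (hfA c₁) (hfA c₂) (qmap fA rfl rfl q) = qmap (algebraMap k₀ F) rfl rfl q := by
  ext
  · exact hfA _
  · exact hfA _
  · exact hfA _
  · exact hfA _

theorem auxQ_val {k₀ L F : Type*} [Field k₀] [Field L] [Field F] [Algebra k₀ F]
    (A : ValuationSubring L) (ρ : A →+* F) (hρ : ∀ x : A, ρ x ≠ 0 → (x : L)⁻¹ ∈ A)
    (fA : k₀ →+* A)
    (hfA : ∀ c, ρ (fA c) = algebraMap k₀ F c) (c₁ c₂ : k₀) (q : ℍ[k₀,c₁,c₂]) (hq : q ≠ 0) :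
    auxw A (auxQ A fA c₁ c₂ q) = 1 := by
  refine le_antisymm (auxw_le A _ _ _) (not_lt.1 fun h => hq ?_)
  unfold auxQ at h
  rw [auxw_res A ρ hρ (fA c₁) (fA c₂) _ _ (hfA c₁) (hfA c₂), auxQ_res] at h
  ext
  · exact (map_eq_zero (algebraMap k₀ F)).1 (congrArg QuaternionAlgebra.re h)
  · exact (map_eq_zero (algebraMap k₀ F)).1 (congrArg QuaternionAlgebra.imI h)
  · exact (map_eq_zero (algebraMap k₀ F)).1 (congrArg QuaternionAlgebra.imJ h)
  · exact (map_eq_zero (algebraMap k₀ F)).1 (congrArg QuaternionAlgebra.imK h)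

theorem aux_red {k₀ L F : Type*} [Field k₀] [Field L] [Field F] [Algebra k₀ F]
    (A : ValuationSubring L) (ρ : A →+* F) (hρ : ∀ x : A, ρ x ≠ 0 → (x : L)⁻¹ ∈ A)
    (fA : k₀ →+* A)
    (hfA : ∀ c, ρ (fA c) = algebraMap k₀ F c) (c₁ c₂ : k₀) (q₀ q₁ : ℍ[k₀,c₁,c₂])
    (g : ℍ[L,(fA c₁ : L),(fA c₂ : L)]) (s r x : L) (hs : s ≠ 0) (hr : r ≠ 0) (hx : x ≠ 0)
    (hv : A.valuation s * A.valuation x ^ 2 = A.valuation r)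
    (hw : auxw A (star g * (algebraMap L _ s * auxQ A fA c₁ c₂ q₁) * g -
      algebraMap L _ r * auxQ A fA c₁ c₂ q₀) < A.valuation r)
    (Y : ℍ[A,fA c₁,fA c₂]) (hY : auxι A _ _ Y = x⁻¹ • g) (U : A) (hU : (U : L) = r / (s * x ^ 2)) :
    star (qmap ρ (hfA c₁) (hfA c₂) Y) * qmap (algebraMap k₀ F) rfl rfl q₁ *
      qmap ρ (hfA c₁) (hfA c₂) Y =
      algebraMap F _ (ρ U) * qmap (algebraMap k₀ F) rfl rfl q₀ := by
  have hr' : A.valuation r ≠ 0 := (Valuation.ne_zero_iff _).2 hr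
  have key : auxι A _ _ (star Y * qmap fA rfl rfl q₁ * Y - algebraMap A _ U * qmap fA rfl rfl q₀) =
      (s * x ^ 2)⁻¹ • (star g * (algebraMap L _ s * auxQ A fA c₁ c₂ q₁) * g -
      algebraMap L _ r * auxQ A fA c₁ c₂ q₀) := by
    have h1 : auxι A (fA c₁) (fA c₂) (star Y) = x⁻¹ • star g := by
      have h0 : auxι A (fA c₁) (fA c₂) (star Y) = star (auxι A (fA c₁) (fA c₂) Y) :=
        qmap_star _ _ _ _
      rw [h0, hY]
      ext <;> simp
    have h2 : auxι A (fA c₁) (fA c₂) (algebraMap A _ U) = algebraMap L _ (U : L) :=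
      qmap_algebraMap _ _ _ _
    rw [map_sub, map_mul, map_mul, map_mul, h1, h2, hY, hU, smul_sub]
    change _ * auxQ A fA c₁ c₂ q₁ * _ - _ * auxQ A fA c₁ c₂ q₀ = _
    rw [← Algebra.smul_def, ← Algebra.smul_def, ← Algebra.smul_def, mul_smul_comm, smul_mul_assoc,
      smul_mul_assoc, mul_smul_comm, smul_mul_assoc, smul_smul, smul_smul, smul_smul]
    congr 2
    · field_simp
    · field_simp
  have h3 : auxw A (auxι A _ _ (star Y * qmap fA rfl rfl q₁ * Y -
      algebraMap A _ U * qmap fA rfl rfl q₀)) < 1 := by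
    rw [key, auxw_smul, map_inv₀, map_mul, map_pow, hv]
    calc _ < (A.valuation r)⁻¹ * A.valuation r :=
          mul_lt_mul_of_pos_left hw (by rw [inv_pos]; exact zero_lt_iff.2 hr')
      _ = 1 := inv_mul_cancel₀ hr'
  rw [auxw_res A ρ hρ (fA c₁) (fA c₂) _ _ (hfA c₁) (hfA c₂), map_sub, map_mul, map_mul, map_mul,
    auxQ_res, auxQ_res, qmap_star, qmap_algebraMap, sub_eq_zero] at h3
  exact h3

theorem aux_prod {L : Type*} [Field L] {n : ℕ} (t : Fin n → L) (i : Fin n) :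
    ∏ p, t p ^ (if p = i then 1 else 0) = t i := by
  simp [pow_ite]


theorem aux_main {k₀ L F : Type*} [Field k₀] [CharZero k₀] [Field L] [Field F] [Algebra k₀ F]
    [FiniteDimensional k₀ F] (hodd : Odd (Module.finrank k₀ F))
    (A : ValuationSubring L) (ρ : A →+* F) (hρ : ∀ x : A, ρ x ≠ 0 → (x : L)⁻¹ ∈ A)
    (fA : k₀ →+* A) (hfA : ∀ c, ρ (fA c) = algebraMap k₀ F c)
    (hhens : ∀ x : A, ρ x ≠ 0 → (∃ r, r ^ 2 = ρ x) → ∃ r : L, r ^ 2 = x)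
    {n : ℕ} (i0 i1 : Fin n) (h01 : i1 ≠ i0) (t : Fin n → L) (ht : ∀ i, t i ≠ 0)
    (hind : ∀ (c : Fin n → ℕ) (z : L), z ≠ 0 →
      A.valuation ((∏ i, t i ^ c i) * z ^ 2) = 1 → ∀ i, Even (c i))
    (c₁ c₂ : k₀) (h : ∀ z : ℍ[k₀,c₁,c₂], qN z = 0 → z = 0)
    (q : Fin n → ℍ[k₀,c₁,c₂]) (hqpure : ∀ i, star (q i) = -(q i))
    (hqne : ∀ i, q i ≠ 0)
    (a : Fin n → k₀) (ha : ∀ i, q i * q i = algebraMap k₀ ℍ[k₀,c₁,c₂] (a i))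
    (hnotsim : ¬ ∃ (lam : k₀) (c : ℍ[k₀,c₁,c₂]), lam ≠ 0 ∧ c ≠ 0 ∧
      q i1 = lam • (star c * q i0 * c))
    (g : Matrix (Fin n) (Fin n) ℍ[L,(fA c₁ : L),(fA c₂ : L)]) (lam : L) (hlam : lam ≠ 0)
    (hsq : ¬ ∃ b : L, b * b = lam)
    (e1 : ∀ j, star (g j j) * (algebraMap L _ (t j) * auxQ A fA c₁ c₂ (q j)) =
      (algebraMap L _ (t j) * auxQ A fA c₁ c₂ (q j)) * g j j)
    (e2 : ∀ j, ∑ i, star (g i j) * (algebraMap L _ (t i) * auxQ A fA c₁ c₂ (q i)) * g i j =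
      algebraMap L _ (lam * t j) * auxQ A fA c₁ c₂ (q j)) :
    ∃ μ : k₀, μ ≠ 0 ∧ ∀ i, Nonempty (ℍ[k₀,c₁,c₂] ≃ₐ[k₀] ℍ[k₀, a i, μ]) := by
  have hF : ∀ z : ℍ[F,algebraMap k₀ F c₁,algebraMap k₀ F c₂], qN z = 0 → z = 0 :=
    aux_aniso_odd k₀ F hodd h
  have nzd := aux_noZeroDiv hF
  obtain ⟨w, hw⟩ := aux_qval A ρ hρ (fA c₁) (fA c₂) _ _ (hfA c₁) (hfA c₂) nzd
  have hv0 : ∀ {x : L}, x ≠ 0 → A.valuation x ≠ 0 := fun hx => (Valuation.ne_zero_iff _).2 hx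
  have hQ : ∀ j, w (auxQ A fA c₁ c₂ (q j)) = 1 := fun j => by
    rw [hw, auxQ_val A ρ hρ fA hfA c₁ c₂ _ (hqne j)]
  have hwa : ∀ x, w (algebraMap L _ x) = A.valuation x := fun x => by rw [hw, auxw_algebraMap]
  have hterm : ∀ i j, w (star (g i j) * (algebraMap L _ (t i) * auxQ A fA c₁ c₂ (q i)) * g i j) =
      A.valuation (t i) * auxw A (g i j) ^ 2 := by
    intro i j
    rw [map_mul, map_mul, map_mul, hQ, hwa, hw, hw, auxw_star, mul_one]
    rw [pow_two]
    ac_rfl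
  have hrhs : ∀ j, w (algebraMap L _ (lam * t j) * auxQ A fA c₁ c₂ (q j)) =
      A.valuation (lam * t j) := by
    intro j
    rw [map_mul, hQ, hwa, mul_one]
  -- the dominating terms
  have hdom : ∀ j, ∃ i, A.valuation (t i) * auxw A (g i j) ^ 2 = A.valuation (lam * t j) ∧
      auxw A (star (g i j) * (algebraMap L _ (t i) * auxQ A fA c₁ c₂ (q i)) * g i j -
        algebraMap L _ (lam * t j) * auxQ A fA c₁ c₂ (q j)) < A.valuation (lam * t j) := by
    intro j
    obtain ⟨i, hi1, hi2⟩ := aux_val_sum w _ _ (by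
      rw [hrhs]; exact hv0 (mul_ne_zero hlam (ht j))) (e2 j) (by
      intro i i' hne h0 heq
      rw [hterm] at h0
      rw [hterm, hterm] at heq
      obtain ⟨x, hx⟩ := auxw_exists A (g i j)
      obtain ⟨x', hx'⟩ := auxw_exists A (g i' j)
      rw [← hx] at h0 heq
      rw [← hx'] at heq
      have hx0 : x ≠ 0 := by
        rintro rfl
        simp at h0
      have hx0' : x' ≠ 0 := by
        rintro rfl
        rw [heq] at h0
        simp at h0
      have := hind (fun p => (if p = i then 1 else 0) + (if p = i' then 1 else 0))
        (x / (x' * t i')) (div_ne_zero hx0 (mul_ne_zero hx0' (ht i'))) (by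
          simp only [pow_add, Finset.prod_mul_distrib, aux_prod]
          have e : t i * t i' * (x / (x' * t i')) ^ 2 = (t i * x ^ 2) / (t i' * x' ^ 2) := by
            have := ht i'
            field_simp
          rw [e, map_div₀, map_mul, map_mul, map_pow, map_pow, heq, div_self]
          rw [← heq]; exact h0) i
      simp [hne] at this)
    rw [hterm, hrhs] at hi1
    rw [hw, hrhs] at hi2
    exact ⟨i, hi1, hi2⟩
  choose τ hτ1 hτ2 using hdom
  choose x hx using fun j => auxw_exists A (g (τ j) j)
  have hx0 : ∀ j, x j ≠ 0 := by
    intro j h0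
    have := hτ1 j
    rw [← hx, h0, map_zero, zero_pow two_ne_zero, mul_zero] at this
    exact hv0 (mul_ne_zero hlam (ht j)) this.symm
  have hval : ∀ j, A.valuation (t (τ j)) * A.valuation (x j) ^ 2 = A.valuation (lam * t j) := by
    intro j
    rw [hx, hτ1]
  have hone : ∀ j, A.valuation (t (τ j) * x j ^ 2 / (lam * t j)) = 1 := by
    intro j
    rw [map_div₀, map_mul, map_pow, hval, div_self (hv0 (mul_ne_zero hlam (ht j)))]
  have hfour : ∀ j j' p, Even ((((if p = j then 1 else 0) + (if p = τ j then 1 else 0)) +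
      (if p = j' then 1 else 0)) + (if p = τ j' then 1 else 0) : ℕ) := by
    intro j j'
    refine hind _ (x j * x j' / (lam * t j * t j')) (div_ne_zero (mul_ne_zero (hx0 _) (hx0 _))
      (mul_ne_zero (mul_ne_zero hlam (ht _)) (ht _))) ?_
    simp only [pow_add, Finset.prod_mul_distrib, aux_prod]
    have e : t j * t (τ j) * t j' * t (τ j') * (x j * x j' / (lam * t j * t j')) ^ 2 =
        (t (τ j) * x j ^ 2 / (lam * t j)) * (t (τ j') * x j' ^ 2 / (lam * t j')) := by
      have := ht j
      have := ht j'
      field_simp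
    rw [e, map_mul, hone, hone, mul_one]
  by_cases hfix : ∃ j, τ j = j
  · -- the diagonal case
    obtain ⟨j₀, hj₀⟩ := hfix
    have hall : ∀ j, τ j = j := by
      intro j
      have h1 := hfour j₀ j j
      rw [hj₀] at h1
      by_contra hne
      have hne' : ¬ (j = τ j) := fun e => hne e.symm
      rw [if_pos rfl, if_neg hne'] at h1
      split_ifs at h1 <;> revert h1 <;> decide
    have hsqv : ∀ j, auxw A (g j j) ^ 2 = A.valuation lam := by
      intro j
      have := hτ1 j
      rw [hall, map_mul, mul_comm] at this
      exact mul_right_cancel₀ (hv0 (ht j)) this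
    obtain ⟨z, hz⟩ : ∃ z, z = x j₀ := ⟨_, rfl⟩
    have hz0 : z ≠ 0 := hz ▸ hx0 j₀
    have hzv : A.valuation z ^ 2 = A.valuation lam := by
      rw [hz, hx, hall, hsqv]
    have huv : A.valuation (lam / z ^ 2) = 1 := by
      rw [map_div₀, map_pow, hzv, div_self (hv0 hlam)]
    obtain ⟨U, hU⟩ : ∃ U : A, (U : L) = lam / z ^ 2 :=
      ⟨⟨_, (A.valuation_le_one_iff _).1 huv.le⟩, rfl⟩
    have hρU : ρ U ≠ 0 := by
      intro h0
      have := (auxw_lt A ρ hρ U).2 h0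
      rw [hU, huv] at this
      exact lt_irrefl _ this
    have hUsq : ¬ ∃ r, r ^ 2 = ρ U := by
      intro hr
      obtain ⟨r, hr⟩ := hhens U hρU hr
      refine hsq ⟨r * z, ?_⟩
      rw [hU] at hr
      rw [← pow_two, mul_pow, hr, div_mul_cancel₀ _ (pow_ne_zero 2 hz0)]
    refine ⟨Algebra.norm k₀ (ρ U), Algebra.norm_ne_zero_iff.2 hρU, fun j => ?_⟩
    have hy1 : auxw A (z⁻¹ • g j j) ≤ 1 := by
      have h1 : auxw A (z⁻¹ • g j j) ^ 2 = 1 := by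
        rw [auxw_smul, mul_pow, hsqv, map_inv₀, inv_pow, hzv, inv_mul_cancel₀ (hv0 hlam)]
      by_contra hlt
      rw [not_le] at hlt
      exact (one_lt_pow₀ hlt two_ne_zero).ne' h1
    obtain ⟨Y, hY⟩ := auxw_lift A _ _ _ hy1
    have hred := aux_red A ρ hρ fA hfA c₁ c₂ (q j) (q j) (g j j) (t j) (lam * t j) z (ht j)
      (mul_ne_zero hlam (ht j)) hz0 (by rw [hzv, map_mul, mul_comm]) (by
        have := hτ2 j
        rw [hall j] at this
        exact this) Y hY U (by
        rw [hU]
        have := ht j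
        field_simp)
    have hcomm : star (qmap ρ (hfA c₁) (hfA c₂) Y) * qmap (algebraMap k₀ F) rfl rfl (q j) =
        qmap (algebraMap k₀ F) rfl rfl (q j) * qmap ρ (hfA c₁) (hfA c₂) Y := by
      have h3 : auxι A _ _ (star Y * qmap fA rfl rfl (q j) - qmap fA rfl rfl (q j) * Y) = 0 := by
        have h0 : auxι A (fA c₁) (fA c₂) (star Y) = star (auxι A (fA c₁) (fA c₂) Y) :=
          qmap_star _ _ _ _
        have h1 : star (z⁻¹ • g j j) = z⁻¹ • star (g j j) := by
          ext <;> simp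
        have h2 := e1 j
        rw [← Algebra.smul_def, mul_smul_comm, smul_mul_assoc] at h2
        have h4 := congrArg (fun y => (t j)⁻¹ • y) h2
        simp only [smul_smul, inv_mul_cancel₀ (ht j), one_smul] at h4
        rw [map_sub, map_mul, map_mul, h0, hY, h1]
        change _ * auxQ A fA c₁ c₂ (q j) - auxQ A fA c₁ c₂ (q j) * _ = _
        rw [smul_mul_assoc, mul_smul_comm, h4, sub_self]
      have h5 := (auxw_res A ρ hρ (fA c₁) (fA c₂) _ _ (hfA c₁) (hfA c₂)
        (star Y * qmap fA rfl rfl (q j) - qmap fA rfl rfl (q j) * Y)).1 (by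
          rw [h3, (auxw_zero A _).2 rfl]; exact zero_lt_one)
      rw [map_sub, map_mul, map_mul, auxQ_res, qmap_star, sub_eq_zero] at h5
      exact h5
    have hq0 : qmap (algebraMap k₀ F) (a' := algebraMap k₀ F c₁) (b' := algebraMap k₀ F c₂)
        rfl rfl (q j) ≠ 0 := by
      intro h0
      have h1 := congrArg qN h0
      rw [qmap_qN] at h1
      refine hqne j (h _ ((map_eq_zero (algebraMap k₀ F)).1 (h1.trans ?_)))
      simp [qN]
    refine aux_slot hodd h (q j) (hqpure j) (hqne j) (a j) (ha j) (ρ U) hUsq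
      (qmap ρ (hfA c₁) (hfA c₂) Y) ?_ hcomm
    rw [hcomm, mul_assoc, Algebra.commutes] at hred
    exact mul_left_cancel₀ hq0 hred
  · -- the off-diagonal case contradicts non-similarity
    exfalso
    apply hnotsim
    have hτ : τ i0 = i1 := by
      by_contra hne
      have h1 := hfour i0 i1 i1
      rw [if_neg h01, if_neg (fun e => hne e.symm), if_pos rfl,
        if_neg (fun e => hfix ⟨i1, e.symm⟩)] at h1
      revert h1
      decide
    obtain ⟨z, hz⟩ : ∃ z, z = x i0 := ⟨_, rfl⟩
    have hz0 : z ≠ 0 := hz ▸ hx0 i0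
    have hzv : A.valuation z = auxw A (g i1 i0) := by rw [hz, hx, hτ]
    have hzval : A.valuation (t i1) * A.valuation z ^ 2 = A.valuation (lam * t i0) := by
      have := hval i0
      rw [hτ, ← hz] at this
      exact this
    have huv : A.valuation (lam * t i0 / (t i1 * z ^ 2)) = 1 := by
      rw [map_div₀, map_mul _ (t i1), map_pow, hzval, div_self (hv0 (mul_ne_zero hlam (ht _)))]
    obtain ⟨U, hU⟩ : ∃ U : A, (U : L) = lam * t i0 / (t i1 * z ^ 2) :=
      ⟨⟨_, (A.valuation_le_one_iff _).1 huv.le⟩, rfl⟩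
    have hρU : ρ U ≠ 0 := by
      intro h0
      have := (auxw_lt A ρ hρ U).2 h0
      rw [hU, huv] at this
      exact lt_irrefl _ this
    obtain ⟨Y, hY⟩ := auxw_lift A (fA c₁) (fA c₂) (z⁻¹ • g i1 i0) (by
      rw [auxw_smul, ← hzv, ← map_mul, inv_mul_cancel₀ hz0, map_one])
    have hred := aux_red A ρ hρ fA hfA c₁ c₂ (q i0) (q i1) (g i1 i0) (t i1) (lam * t i0) z (ht i1)
      (mul_ne_zero hlam (ht i0)) hz0 hzval (by
        have := hτ2 i0
        rw [hτ] at this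
        exact this) Y hY U hU
    exact aux_sim hodd h (q i0) (q i1) (hqpure _) (hqne _) (a i0) (ha _) (hqpure _) (hqne _) (a i1)
      (ha _) (ρ U) hρU _ hred

/-- Let `Q = (c₁,c₂)_{k₀}` be a quaternion division algebra over a
field `k₀` of characteristic 0, `q₁, …, q_n` (`n ≥ 2`) nonzero pure quaternions with
`qᵢ² = aᵢ ∈ k₀^×`, `k = k₀((t₁))…((t_n))`, and let `σ(X) = D⁻¹(X̄)ᵀD` be the adjoint
involution of the skew-hermitian form `⟨t₁q₁, …, t_nq_n⟩` on `M_n(Q ⊗ k)`, where `D` is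
the diagonal matrix with entries `tᵢqᵢ`.  Suppose `⟨q₁⟩` and `⟨q₂⟩` are not similar.
If `ℓ/k` is a field extension of odd finite degree and `g ∈ M_n(Q ⊗ ℓ)` satisfies
`σ_ℓ(g) = g` (i.e. `(ḡ)ᵀ·D = D·g`) and `g² = λ·1` with `λ ∈ ℓ^×` a nonsquare, then
there is `μ ∈ k₀^×` with `Q ≃ (aᵢ, μ)_{k₀}` for every `i`. -/
theorem common_slot_of_odd_degree_symmetric_square_root
    (k₀ : Type*) [Field k₀] [CharZero k₀] (c₁ c₂ : k₀)
    (hdiv : ∀ z : ℍ[k₀,c₁,c₂], z ≠ 0 → IsUnit z)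
    (n : ℕ) (hn : 2 ≤ n)
    (q : Fin n → ℍ[k₀,c₁,c₂]) (hqpure : ∀ i, star (q i) = -(q i))
    (hqne : ∀ i, q i ≠ 0)
    (a : Fin n → k₀) (ha : ∀ i, q i * q i = algebraMap k₀ ℍ[k₀,c₁,c₂] (a i))
    (hnotsim : ¬ ∃ (lam : k₀) (c : ℍ[k₀,c₁,c₂]), lam ≠ 0 ∧ c ≠ 0 ∧
      q ⟨1, by omega⟩ = lam • (star c * q ⟨0, by omega⟩ * c))
    (ℓ : Type*) [Field ℓ] [Algebra (IterLaurent k₀ n) ℓ]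
    [FiniteDimensional (IterLaurent k₀ n) ℓ]
    (hodd : Odd (Module.finrank (IterLaurent k₀ n) ℓ)) :
    ∀ f : k₀ →+* ℓ,
      f = (algebraMap (IterLaurent k₀ n) ℓ).comp (iterLaurentEmb k₀ n) →
      ∀ D : Matrix (Fin n) (Fin n) ℍ[ℓ, f c₁, f c₂],
        D = Matrix.diagonal (fun i =>
          algebraMap ℓ ℍ[ℓ, f c₁, f c₂]
              (algebraMap (IterLaurent k₀ n) ℓ (iterLaurentVar k₀ n i)) *
            quatMap c₁ c₂ f (q i)) →
        ∀ (g : Matrix (Fin n) (Fin n) ℍ[ℓ, f c₁, f c₂]) (lam : ℓ),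
          lam ≠ 0 → (¬ ∃ b : ℓ, b * b = lam) →
          Matrix.transpose (g.map star) * D = D * g →
          g * g = lam • (1 : Matrix (Fin n) (Fin n) ℍ[ℓ, f c₁, f c₂]) →
          ∃ μ : k₀, μ ≠ 0 ∧
            ∀ i, Nonempty (ℍ[k₀,c₁,c₂] ≃ₐ[k₀] ℍ[k₀, a i, μ]) := by
  intro f hf
  subst hf
  intro D hD g lam hlam hsq hg1 hg2
  obtain ⟨A, F, hF1, hF2, hF3, ρ, hodd', hρ, hk, hind, hhens⟩ := aux_val k₀ n ℓ hodd
  have h := fun z => qN_aniso hdiv z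
  let fA : k₀ →+* A := RingHom.codRestrict
    ((algebraMap (IterLaurent k₀ n) ℓ).comp (iterLaurentEmb k₀ n)) A.toSubring
    (fun c => (hk c).choose)
  have hfA : ∀ c, ρ (fA c) = algebraMap k₀ F c := fun c => (hk c).choose_spec
  have ht : ∀ i, algebraMap (IterLaurent k₀ n) ℓ (iterLaurentVar k₀ n i) ≠ 0 := fun i =>
    (map_ne_zero _).2 (aux_var_ne_zero k₀ n i)
  refine aux_main hodd' A ρ hρ fA hfA hhens _ _ (fun e => absurd (congrArg Fin.val e) one_ne_zero)
    (fun i => algebraMap (IterLaurent k₀ n) ℓ (iterLaurentVar k₀ n i)) ht ?_ c₁ c₂ h q hqpure hqne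
    a ha hnotsim g lam hlam hsq ?_ ?_
  · intro c z hz hv
    refine hind c z hz ((A.valuation_le_one_iff _).1 hv.le) ((A.valuation_le_one_iff _).1 ?_)
    rw [map_inv₀, hv, inv_one]
  · intro j
    have h1 := congrFun (congrFun hg1 j) j
    rw [hD, Matrix.mul_diagonal, Matrix.diagonal_mul] at h1
    exact h1
  · intro j
    have h2 : Matrix.transpose (g.map star) * D * g = lam • D := by
      rw [hg1, mul_assoc, hg2, Matrix.mul_smul, mul_one]
    have h1 := congrFun (congrFun h2 j) j
    rw [hD, Matrix.mul_apply, Matrix.smul_apply, Matrix.diagonal_apply_eq] at h1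
    simp only [Matrix.mul_diagonal] at h1
    rw [Algebra.smul_def, ← mul_assoc, ← map_mul] at h1
    exact h1

end
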